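/- arXiv:1811.09972 — 4 statements merged into one kernel-verified Lean document; each statement's English description precedes it below -/
import Mathlib

section
/- For every c₀ > 0 there exists a constant C > 0, depending only on d, α₁, α₂, c₀, such that for all t ∈ (0,1] and all y, w ∈ ℝ^d with |w| > 2c₀: (i) ∫_{|z|≤c₀} min(t^{−2/α(y)} |z|², 1) · (ρ₁^{y,0}(t, w+z) + ρ₁^{y,0}(t,w)) · |z|^{−(d+α₂)} dz ≤ C t^{1 − α₂/α₁} |w|^{−(d+α₁)}; and (ii) ∫_{|z|≤c₀} min(t^{−2/α(y)} |z|², 1) · (ρ₁^{y,0}(t, w+z) + ρ₁^{y,0}(t,w)) · (1 + |log|z||) |z|^{−(d+α₂)} dz ≤ C (1 + |log t| + |log|w||) t^{1 − α₂/α₁} |w|^{−(d+α₁)}. -/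
open MeasureTheory Real Set

noncomputable def rho (d : ℕ) (α : EuclideanSpace ℝ (Fin d) → ℝ) (α₁ : ℝ)
    (γ : ℝ) (y : EuclideanSpace ℝ (Fin d)) (β : ℝ) (t : ℝ)
    (x : EuclideanSpace ℝ (Fin d)) : ℝ :=
  t ^ γ * min (‖x‖ ^ β) 1 *
    (if ‖x‖ ≤ 1 then (t ^ (1 / α y) + ‖x‖) ^ (-((d : ℝ) + α y))
     else ‖x‖ ^ (-((d : ℝ) + α₁)))

/-- The radial profile `min (r², 1) (1 + |log r|) r ^ (-p)`, which dominates both integrands after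
rescaling. -/
noncomputable def logKernel (p r : ℝ) : ℝ :=
  min (r ^ 2) 1 * ((1 + |Real.log r|) * r ^ (-p))

lemma logKernel_nonneg (p : ℝ) {r : ℝ} (hr : 0 ≤ r) : 0 ≤ logKernel p r := by
  unfold logKernel
  positivity

lemma measurable_logKernel (p : ℝ) : Measurable (logKernel p) := by
  unfold logKernel
  exact ((measurable_id.pow_const 2).min measurable_const).mul
    ((measurable_const.add Real.measurable_log.abs).mul (measurable_id.pow_const _))

lemma one_add_abs_log_le_rpow_neg {r ε : ℝ} (hr : 0 < r) (hr1 : r ≤ 1) (hε : 0 < ε) :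
    1 + |Real.log r| ≤ (1 + 1 / ε) * r ^ (-ε) := by
  have hone : 1 ≤ r ^ (-ε) := Real.one_le_rpow_of_pos_of_le_one_of_nonpos hr hr1 (by linarith)
  have hlog := Real.log_le_rpow_div (inv_pos.2 hr).le hε
  rw [Real.log_inv, Real.inv_rpow hr.le, ← Real.rpow_neg hr.le] at hlog
  rw [abs_of_nonpos (Real.log_nonpos hr.le hr1)]
  calc 1 + -Real.log r ≤ r ^ (-ε) + r ^ (-ε) / ε := add_le_add hone hlog
    _ = (1 + 1 / ε) * r ^ (-ε) := by ring

lemma one_add_abs_log_le_rpow {r ε : ℝ} (hr1 : 1 ≤ r) (hε : 0 < ε) :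
    1 + |Real.log r| ≤ (1 + 1 / ε) * r ^ ε := by
  have hone : 1 ≤ r ^ ε := Real.one_le_rpow hr1 hε.le
  have hlog := Real.log_le_rpow_div (zero_le_one.trans hr1) hε
  rw [abs_of_nonneg (Real.log_nonneg hr1)]
  calc 1 + Real.log r ≤ r ^ ε + r ^ ε / ε := add_le_add hone hlog
    _ = (1 + 1 / ε) * r ^ ε := by ring

lemma pow_mul_logKernel {d : ℕ} (hd : 1 ≤ d) (a : ℝ) {r : ℝ} (hr : 0 < r) :
    r ^ (d - 1) * logKernel (d + a) r = min (r ^ 2) 1 * (1 + |Real.log r|) * r ^ (-1 - a) := by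
  have h : r ^ (d - 1) * r ^ (-((d : ℝ) + a)) = r ^ (-1 - a) := by
    rw [← Real.rpow_natCast, ← Real.rpow_add hr, Nat.cast_sub hd]
    congr 1
    push_cast
    ring
  rw [logKernel, ← h]
  ring

lemma integrableOn_pow_mul_logKernel {d : ℕ} (hd : 1 ≤ d) {a : ℝ} (ha : 0 < a) (ha2 : a < 2) :
    IntegrableOn (fun r : ℝ ↦ r ^ (d - 1) * logKernel (d + a) r) (Ioi 0) := by
  have hmeas : Measurable fun r : ℝ ↦ r ^ (d - 1) * logKernel (d + a) r :=
    (measurable_id.pow_const _).mul (measurable_logKernel _)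
  rw [← Ioc_union_Ioi_eq_Ioi (zero_le_one' ℝ)]
  refine IntegrableOn.union ?_ ?_
  · have hε : 0 < (2 - a) / 2 := by linarith
    have hint : IntegrableOn (fun r : ℝ ↦ r ^ (1 - a - (2 - a) / 2)) (Ioc 0 1) :=
      (intervalIntegrable_iff_integrableOn_Ioc_of_le zero_le_one).1
        (intervalIntegral.intervalIntegrable_rpow' (by linarith))
    refine Integrable.mono' (hint.const_mul (1 + 1 / ((2 - a) / 2)))
      hmeas.aestronglyMeasurable ?_
    refine ae_restrict_of_forall_mem measurableSet_Ioc fun r hr ↦ ?_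
    have hr0 : 0 < r := hr.1
    rw [pow_mul_logKernel hd a hr0, Real.norm_of_nonneg (by positivity),
      min_eq_left (pow_le_one₀ hr0.le hr.2)]
    calc r ^ 2 * (1 + |Real.log r|) * r ^ (-1 - a)
        ≤ r ^ 2 * ((1 + 1 / ((2 - a) / 2)) * r ^ (-((2 - a) / 2))) * r ^ (-1 - a) := by
          gcongr
          exact one_add_abs_log_le_rpow_neg hr0 hr.2 hε
      _ = (1 + 1 / ((2 - a) / 2)) * (r ^ (2 : ℝ) * r ^ (-((2 - a) / 2)) * r ^ (-1 - a)) := by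
          rw [Real.rpow_two]
          ring
      _ = (1 + 1 / ((2 - a) / 2)) * r ^ (1 - a - (2 - a) / 2) := by
          rw [← Real.rpow_add hr0, ← Real.rpow_add hr0]
          congr 2
          ring
  · have hε : 0 < a / 2 := by linarith
    have hint : IntegrableOn (fun r : ℝ ↦ r ^ (-1 - a + a / 2)) (Ioi 1) :=
      integrableOn_Ioi_rpow_of_lt (by linarith) one_pos
    refine Integrable.mono' (hint.const_mul (1 + 1 / (a / 2))) hmeas.aestronglyMeasurable ?_
    refine ae_restrict_of_forall_mem measurableSet_Ioi fun r hr ↦ ?_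
    have hr1 : 1 ≤ r := le_of_lt hr
    have hr0 : 0 < r := by linarith
    rw [pow_mul_logKernel hd a hr0, Real.norm_of_nonneg (by positivity),
      min_eq_right (one_le_pow₀ hr1)]
    calc 1 * (1 + |Real.log r|) * r ^ (-1 - a)
        ≤ 1 * ((1 + 1 / (a / 2)) * r ^ (a / 2)) * r ^ (-1 - a) := by
          gcongr
          exact one_add_abs_log_le_rpow hr1 hε
      _ = (1 + 1 / (a / 2)) * r ^ (-1 - a + a / 2) := by
          rw [Real.rpow_add hr0]
          ring

lemma integrable_logKernel_norm {d : ℕ} (hd : 1 ≤ d) {a : ℝ} (ha : 0 < a) (ha2 : a < 2) :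
    Integrable fun u : EuclideanSpace ℝ (Fin d) ↦ logKernel (d + a) ‖u‖ := by
  have : Nonempty (Fin d) := ⟨⟨0, hd⟩⟩
  refine (integrable_fun_norm_addHaar volume (f := logKernel (d + a))).2 ?_
  simpa using integrableOn_pow_mul_logKernel hd ha ha2

lemma setLIntegral_ofReal_le_of_le_rescaled {d : ℕ} {S : Set (EuclideanSpace ℝ (Fin d))}
    (hS : MeasurableSet S) {F G : EuclideanSpace ℝ (Fin d) → ℝ} (hG : Integrable G)
    (hG0 : ∀ u, 0 ≤ G u) {s M : ℝ} (hs : 0 < s) (hM : 0 ≤ M)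
    (hF : ∀ z ∈ S, F z ≤ M * G (s⁻¹ • z)) :
    ∫⁻ z in S, ENNReal.ofReal (F z) ≤ ENNReal.ofReal (M * (s ^ d * ∫ u, G u)) := by
  calc ∫⁻ z in S, ENNReal.ofReal (F z)
      ≤ ∫⁻ z in S, ENNReal.ofReal (M * G (s⁻¹ • z)) :=
        setLIntegral_mono' hS fun z hz ↦ ENNReal.ofReal_le_ofReal (hF z hz)
    _ ≤ ∫⁻ z, ENNReal.ofReal (M * G (s⁻¹ • z)) := setLIntegral_le_lintegral _ _
    _ = ENNReal.ofReal (∫ z, M * G (s⁻¹ • z)) :=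
        (ofReal_integral_eq_lintegral_ofReal
          ((hG.comp_smul (inv_ne_zero hs.ne')).const_mul M)
          (Filter.Eventually.of_forall fun z ↦ mul_nonneg hM (hG0 _))).symm
    _ = ENNReal.ofReal (M * (s ^ d * ∫ u, G u)) := by
        rw [integral_const_mul, Measure.integral_comp_smul]
        simp [abs_of_pos hs]

lemma one_le_one_add_abs (x : ℝ) : 1 ≤ 1 + |x| := by
  linarith [abs_nonneg x]

lemma min_mul_rpow_le_logKernel {s r : ℝ} (p : ℝ) (hs : 0 < s) (hr : 0 ≤ r) :
    min ((s⁻¹ * r) ^ 2) 1 * r ^ (-p) ≤ s ^ (-p) * logKernel p (s⁻¹ * r) := by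
  have hrp : r ^ (-p) = s ^ (-p) * (s⁻¹ * r) ^ (-p) := by
    rw [← Real.mul_rpow hs.le (by positivity), mul_inv_cancel_left₀ hs.ne']
  have hu : 0 ≤ s⁻¹ * r := by positivity
  rw [hrp, logKernel]
  generalize s⁻¹ * r = u at hu ⊢
  calc min (u ^ 2) 1 * (s ^ (-p) * u ^ (-p))
      = s ^ (-p) * (min (u ^ 2) 1 * (1 * u ^ (-p))) := by ring
    _ ≤ s ^ (-p) * (min (u ^ 2) 1 * ((1 + |Real.log u|) * u ^ (-p))) := by
        gcongr
        exact one_le_one_add_abs _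

lemma min_mul_log_rpow_le_logKernel {s r : ℝ} (p : ℝ) (hs : 0 < s) (hr : 0 ≤ r) :
    min ((s⁻¹ * r) ^ 2) 1 * ((1 + |Real.log r|) * r ^ (-p)) ≤
      s ^ (-p) * (1 + |Real.log s|) * logKernel p (s⁻¹ * r) := by
  rcases hr.eq_or_lt with rfl | hr
  · simp [logKernel]
  have hu : 0 < s⁻¹ * r := by positivity
  have hr_eq : r = s * (s⁻¹ * r) := (mul_inv_cancel_left₀ hs.ne' r).symm
  have hrp : r ^ (-p) = s ^ (-p) * (s⁻¹ * r) ^ (-p) := by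
    rw [← Real.mul_rpow hs.le hu.le, ← hr_eq]
  have hlog : 1 + |Real.log r| ≤ (1 + |Real.log s|) * (1 + |Real.log (s⁻¹ * r)|) := by
    have heq : Real.log r = Real.log s + Real.log (s⁻¹ * r) := by
      rw [← Real.log_mul hs.ne' hu.ne', ← hr_eq]
    rw [heq]
    have := abs_add_le (Real.log s) (Real.log (s⁻¹ * r))
    nlinarith [mul_nonneg (abs_nonneg (Real.log s)) (abs_nonneg (Real.log (s⁻¹ * r)))]
  rw [hrp, logKernel]
  calc _ ≤ min ((s⁻¹ * r) ^ 2) 1 * ((1 + |Real.log s|) * (1 + |Real.log (s⁻¹ * r)|) *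
        (s ^ (-p) * (s⁻¹ * r) ^ (-p))) := by gcongr
    _ = _ := by ring

lemma rho_one_zero_le {d : ℕ} {α : EuclideanSpace ℝ (Fin d) → ℝ} {α₁ α₂ c t : ℝ} (h1 : 0 < α₁)
    {y : EuclideanSpace ℝ (Fin d)} (hα : α y ∈ Icc α₁ α₂) (hc : 0 < c) (ht : 0 < t)
    {x : EuclideanSpace ℝ (Fin d)} (hx : c ≤ ‖x‖) :
    rho d α α₁ 1 y 0 t x ≤
      t * (max 1 (c ^ (-(α₂ - α₁))) * ‖x‖ ^ (-((d : ℝ) + α₁))) := by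
  have hx0 : 0 < ‖x‖ := hc.trans_le hx
  simp only [rho, Real.rpow_one, Real.rpow_zero, min_self, mul_one]
  gcongr
  split_ifs with hx1
  · calc (t ^ (1 / α y) + ‖x‖) ^ (-((d : ℝ) + α y))
        ≤ ‖x‖ ^ (-((d : ℝ) + α y)) := by
          refine Real.rpow_le_rpow_of_nonpos hx0 (le_add_of_nonneg_left (by positivity)) ?_
          have : (0 : ℝ) ≤ d := d.cast_nonneg
          linarith [hα.1]
      _ = ‖x‖ ^ (-(α y - α₁)) * ‖x‖ ^ (-((d : ℝ) + α₁)) := by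
          rw [← Real.rpow_add hx0]
          congr 1
          ring
      _ ≤ _ := by
          gcongr
          refine le_max_of_le_right ?_
          calc ‖x‖ ^ (-(α y - α₁)) ≤ ‖x‖ ^ (-(α₂ - α₁)) :=
                Real.rpow_le_rpow_of_exponent_ge hx0 hx1 (by linarith [hα.2])
            _ ≤ c ^ (-(α₂ - α₁)) :=
                Real.rpow_le_rpow_of_nonpos hc hx (by linarith [hα.1, hα.2])
  · exact le_mul_of_one_le_left (by positivity) (le_max_left _ _)

lemma rho_add_rho_le {d : ℕ} {α : EuclideanSpace ℝ (Fin d) → ℝ} {α₁ α₂ c t : ℝ} (h1 : 0 < α₁)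
    {y : EuclideanSpace ℝ (Fin d)} (hα : α y ∈ Icc α₁ α₂) (hc : 0 < c) (ht : 0 < t)
    {w z : EuclideanSpace ℝ (Fin d)} (hw : 2 * c < ‖w‖) (hz : ‖z‖ ≤ c) :
    rho d α α₁ 1 y 0 t (w + z) + rho d α α₁ 1 y 0 t w ≤
      max 1 (c ^ (-(α₂ - α₁))) * (2 ^ ((d : ℝ) + α₁) + 1) * t * ‖w‖ ^ (-((d : ℝ) + α₁)) := by
  have hw0 : 0 < ‖w‖ := by linarith
  have hwz : ‖w‖ ≤ ‖w + z‖ + ‖z‖ := by simpa using norm_sub_le (w + z) z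
  have hpow : ‖w + z‖ ^ (-((d : ℝ) + α₁)) ≤ 2 ^ ((d : ℝ) + α₁) * ‖w‖ ^ (-((d : ℝ) + α₁)) := by
    calc ‖w + z‖ ^ (-((d : ℝ) + α₁)) ≤ (2⁻¹ * ‖w‖) ^ (-((d : ℝ) + α₁)) := by
          refine Real.rpow_le_rpow_of_nonpos (by positivity) (by linarith) ?_
          have : (0 : ℝ) ≤ d := d.cast_nonneg
          linarith
      _ = _ := by
          rw [Real.mul_rpow (by norm_num) hw0.le, Real.inv_rpow (by norm_num),
            Real.rpow_neg (by norm_num), inv_inv]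
  calc _ ≤ t * (max 1 (c ^ (-(α₂ - α₁))) * (2 ^ ((d : ℝ) + α₁) * ‖w‖ ^ (-((d : ℝ) + α₁)))) +
        t * (max 1 (c ^ (-(α₂ - α₁))) * ‖w‖ ^ (-((d : ℝ) + α₁))) := by
        refine add_le_add ((rho_one_zero_le h1 hα hc ht (by linarith)).trans ?_)
          (rho_one_zero_le h1 hα hc ht (by linarith))
        gcongr
    _ = _ := by ring

lemma one_add_abs_log_rpow_le {a a' t : ℝ} (ha : 0 < a) (haa : a ≤ a') (ht : 0 < t) :
    1 + |Real.log (t ^ (1 / a'))| ≤ (1 + 1 / a) * (1 + |Real.log t|) := by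
  have ha' : 0 < a' := ha.trans_le haa
  rw [Real.log_rpow ht, abs_mul, abs_of_pos (by positivity : 0 < 1 / a')]
  have h := mul_le_mul_of_nonneg_right (one_div_le_one_div_of_le ha haa) (abs_nonneg (Real.log t))
  have : 0 < 1 / a := by positivity
  nlinarith [abs_nonneg (Real.log t)]

theorem stmt7
    (d : ℕ) (hd : 1 ≤ d)
    (α₁ α₂ : ℝ) (h1 : 0 < α₁) (h12 : α₁ ≤ α₂) (h2 : α₂ < 2)
    (α : EuclideanSpace ℝ (Fin d) → ℝ) (hαm : Measurable α)
    (hαb : ∀ x, α x ∈ Icc α₁ α₂)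
    (c₀ : ℝ) (hc₀ : 0 < c₀) :
    ∃ C > 0, ∀ t ∈ Ioc (0:ℝ) 1, ∀ y w : EuclideanSpace ℝ (Fin d), 2 * c₀ < ‖w‖ →
      ((∫⁻ z in {z : EuclideanSpace ℝ (Fin d) | ‖z‖ ≤ c₀},
          ENNReal.ofReal (min (t ^ (-2 / α y) * ‖z‖ ^ 2) 1 *
            (rho d α α₁ 1 y 0 t (w + z) + rho d α α₁ 1 y 0 t w) *
            ‖z‖ ^ (-((d : ℝ) + α₂))))
        ≤ ENNReal.ofReal (C * t ^ (1 - α₂ / α₁) * ‖w‖ ^ (-((d : ℝ) + α₁)))) ∧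
      ((∫⁻ z in {z : EuclideanSpace ℝ (Fin d) | ‖z‖ ≤ c₀},
          ENNReal.ofReal (min (t ^ (-2 / α y) * ‖z‖ ^ 2) 1 *
            (rho d α α₁ 1 y 0 t (w + z) + rho d α α₁ 1 y 0 t w) *
            ((1 + |Real.log ‖z‖|) * ‖z‖ ^ (-((d : ℝ) + α₂)))))
        ≤ ENNReal.ofReal (C * (1 + |Real.log t| + |Real.log ‖w‖|) *
            t ^ (1 - α₂ / α₁) * ‖w‖ ^ (-((d : ℝ) + α₁)))) := by
  set A : ℝ := max 1 (c₀ ^ (-(α₂ - α₁))) * (2 ^ ((d : ℝ) + α₁) + 1)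
  set G : EuclideanSpace ℝ (Fin d) → ℝ := fun u ↦ logKernel (d + α₂) ‖u‖ with hG
  have hA0 : 0 < A := by positivity
  have hGint : Integrable G := integrable_logKernel_norm hd (h1.trans_le h12) h2
  have hG0 : ∀ u, 0 ≤ G u := fun u ↦ logKernel_nonneg _ (norm_nonneg u)
  have hJ0 : 0 ≤ ∫ u, G u := integral_nonneg hG0
  set J : ℝ := ∫ u, G u
  refine ⟨A * (J + 1) * (1 + 1 / α₁), by positivity, fun t ht y w hw ↦ ?_⟩
  have ht0 : 0 < t := ht.1
  have hαy : 0 < α y := h1.trans_le (hαb y).1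
  have hS : MeasurableSet {z : EuclideanSpace ℝ (Fin d) | ‖z‖ ≤ c₀} :=
    measurableSet_le measurable_norm measurable_const
  set s : ℝ := t ^ (1 / α y) with hs_def
  have hs : 0 < s := by positivity
  have hscale : t ^ (-2 / α y) = s⁻¹ ^ 2 := by
    rw [hs_def, inv_pow, ← Real.rpow_two, ← Real.rpow_mul ht0.le, ← Real.rpow_neg ht0.le]
    congr 1
    ring
  have hnorm (z : EuclideanSpace ℝ (Fin d)) : ‖s⁻¹ • z‖ = s⁻¹ * ‖z‖ := by
    rw [norm_smul, Real.norm_of_nonneg (by positivity)]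
  set B : ℝ := A * t * ‖w‖ ^ (-((d : ℝ) + α₁)) with hB
  have hB0 : 0 ≤ B := by positivity
  have hrho {z : EuclideanSpace ℝ (Fin d)} (hz : ‖z‖ ≤ c₀) :
      rho d α α₁ 1 y 0 t (w + z) + rho d α α₁ 1 y 0 t w ≤ B :=
    rho_add_rho_le h1 (hαb y) hc₀ ht0 hw hz
  have hspow : s ^ (-((d : ℝ) + α₂)) * s ^ d ≤ t ^ (-(α₂ / α₁)) := by
    rw [← Real.rpow_natCast, ← Real.rpow_add hs, hs_def, ← Real.rpow_mul ht0.le]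
    refine Real.rpow_le_rpow_of_exponent_ge ht0 ht.2 ?_
    have := div_le_div_of_nonneg_left (h1.trans_le h12).le h1 (hαb y).1
    calc -(α₂ / α₁) ≤ -(α₂ / α y) := by linarith
      _ = 1 / α y * (-((d : ℝ) + α₂) + d) := by ring
  have htpow : t ^ (1 - α₂ / α₁) = t * t ^ (-(α₂ / α₁)) := by
    rw [sub_eq_add_neg, Real.rpow_add ht0, Real.rpow_one]
  have hbound {L L' : ℝ} (hL : 0 ≤ L) (hLL : L ≤ (1 + 1 / α₁) * L') :
      B * (s ^ (-((d : ℝ) + α₂)) * L) * (s ^ d * J) ≤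
        A * (J + 1) * (1 + 1 / α₁) * L' * t ^ (1 - α₂ / α₁) * ‖w‖ ^ (-((d : ℝ) + α₁)) := by
    calc B * (s ^ (-((d : ℝ) + α₂)) * L) * (s ^ d * J)
        = B * (s ^ (-((d : ℝ) + α₂)) * s ^ d) * L * J := by ring
      _ ≤ B * t ^ (-(α₂ / α₁)) * ((1 + 1 / α₁) * L') * (J + 1) := by
          gcongr
          · exact mul_nonneg (by positivity) (hL.trans hLL)
          · linarith
      _ = _ := by
          rw [htpow, hB]
          ring
  constructor
  · refine (setLIntegral_ofReal_le_of_le_rescaled hS hGint hG0 hs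
      (M := B * (s ^ (-((d : ℝ) + α₂)) * 1)) (by positivity) fun z hz ↦ ?_).trans
      (ENNReal.ofReal_le_ofReal ?_)
    · rw [hscale, ← mul_pow, mul_right_comm, mul_comm, hG, mul_one, mul_assoc B]
      simp only [hnorm]
      exact mul_le_mul (hrho hz) (min_mul_rpow_le_logKernel _ hs (norm_nonneg z))
        (by positivity) hB0
    · have : 0 < 1 / α₁ := by positivity
      simpa only [mul_one] using hbound (L := 1) (L' := 1) zero_le_one (by linarith)
  · refine (setLIntegral_ofReal_le_of_le_rescaled hS hGint hG0 hs
      (M := B * (s ^ (-((d : ℝ) + α₂)) * (1 + |Real.log s|))) (by positivity) fun z hz ↦ ?_).trans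
      (ENNReal.ofReal_le_ofReal ?_)
    · rw [hscale, ← mul_pow, mul_right_comm, mul_comm, hG, mul_assoc B]
      simp only [hnorm]
      exact mul_le_mul (hrho hz) (min_mul_log_rpow_le_logKernel _ hs (norm_nonneg z))
        (by positivity) hB0
    · refine hbound (by positivity) ((one_add_abs_log_rpow_le h1 (hαb y).1 ht0).trans ?_)
      exact mul_le_mul_of_nonneg_left (le_add_of_nonneg_right (abs_nonneg _)) (by positivity)
end

section
/- For every θ₁, θ₂ ∈ ℝ and σ₁, σ₂ ∈ (0,1) there exists a constant C > 0 such that for all 0 < s < t ≤ 1 and x, y ∈ ℝ^d: ∫_{ℝ^d} ρ_{θ₁}^{z,σ₁}(t−s, x−z) ρ_{θ₂}^{y,σ₂}(s, z−y) dz ≤ C { [ (t−s)^{θ₁ + min((σ₁+σ₂)/α₂, 1) − 1} s^{θ₂} (1 + |log(t−s)| 1_{σ₁+σ₂ = α₂}) + (t−s)^{θ₁} s^{θ₂ + min((σ₁+σ₂)/α₂, 1) − 1} (1 + |log s| 1_{σ₁+σ₂ = α₂}) ] ρ₀^{y,0}(t, x−y) + (t−s)^{θ₁ + min(σ₁/α₂,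 1) − 1} s^{θ₂} (1 + |log(t−s)| 1_{σ₁ = α₂}) ρ₀^{y,σ₂}(t, x−y) + (t−s)^{θ₁} s^{θ₂ + min(σ₂/α₂, 1) − 1} (1 + |log s| 1_{σ₂ = α₂}) ρ₀^{y,σ₁}(t, x−y) }. -/
open MeasureTheory Real Set

/-- The spatial profile of `rho` at order `a`, as a function of the radius. -/
noncomputable def radialKernel (D α₁ a t r : ℝ) : ℝ :=
  if r ≤ 1 then (t ^ (1 / a) + r) ^ (-(D + a)) else r ^ (-(D + α₁))

lemma radialKernel_nonneg {D α₁ a t r : ℝ} (ht : 0 ≤ t) (hr : 0 ≤ r) :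
    0 ≤ radialKernel D α₁ a t r := by
  unfold radialKernel
  split_ifs <;> positivity

lemma rpow_neg_le_exp {c b v δ : ℝ} (hb : 0 < b) (hv : 0 < v) (hc : 0 ≤ c) (hv1 : v ≤ 1)
    (hδ : δ ≤ c * v ^ b) : v ^ (-δ) ≤ exp (c / b) := by
  rw [rpow_def_of_pos hv, exp_le_exp]
  have hvb : 0 < v ^ b := rpow_pos_of_pos hv b
  have h1 := one_sub_inv_le_log_of_pos hvb
  rw [log_rpow hv] at h1
  have h2 : v ^ b * (-(b * log v)) ≤ 1 := by
    have := mul_le_mul_of_nonneg_left h1 hvb.le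
    rw [mul_sub, mul_inv_cancel₀ hvb.ne'] at this
    nlinarith
  have hl : 0 ≤ -log v := by linarith [log_nonpos hv.le hv1]
  rw [le_div_iff₀ hb]
  calc log v * -δ * b = δ * (-log v * b) := by ring
    _ ≤ c * v ^ b * (-log v * b) := by gcongr
    _ = c * (v ^ b * (-(b * log v))) := by ring
    _ ≤ c * 1 := by gcongr
    _ = c := mul_one c

/-- Changing an exponent by at most `c * v ^ b` costs a bounded factor on the range `v ≤ X ≤ 2`. -/
lemma rpow_neg_le_of_abs_le {c b v X δ : ℝ} (hb : 0 < b) (hc : 0 ≤ c) (hv : 0 ≤ v) (hv1 : v ≤ 1)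
    (hX : 0 < X) (hX2 : X ≤ 2) (hvX : v ≤ X) (hδ : |δ| ≤ c * v ^ b) (hδ2 : |δ| ≤ 2) :
    X ^ (-δ) ≤ 4 * exp (c / b) := by
  have he : 1 ≤ exp (c / b) := one_le_exp (by positivity)
  rcases le_total δ 0 with h | h
  · have : X ^ (-δ) ≤ 2 ^ (2 : ℝ) := by
      calc X ^ (-δ) ≤ 2 ^ (-δ) := by gcongr; linarith
        _ ≤ 2 ^ (2 : ℝ) := by
          gcongr
          · norm_num
          · linarith [neg_le_abs δ]
    norm_num at this
    linarith
  · rcases hv.eq_or_lt with rfl | hv0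
    · rw [zero_rpow hb.ne', mul_zero] at hδ
      have : δ = 0 := abs_nonpos_iff.1 hδ
      subst this
      simp; linarith
    · calc X ^ (-δ) ≤ v ^ (-δ) := rpow_le_rpow_of_nonpos hv0 hvX (by linarith)
        _ ≤ exp (c / b) := rpow_neg_le_exp hb hv0 hc hv1 ((le_abs_self δ).trans hδ)
        _ ≤ _ := by linarith

lemma radialKernel_le_of_half_le {D α₁ p q τ t r w : ℝ} (hD : 0 ≤ D) (h1 : 0 < α₁)
    (hp : α₁ ≤ p) (hp2 : p ≤ 2) (hq : α₁ ≤ q) (hq2 : q ≤ 2) (hτ : 0 < τ) (ht : 0 < t)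
    (ht1 : t ≤ 1) (hr : 1 / 2 ≤ r) (hw : 0 ≤ w) (hwr : w ≤ 2 * r) :
    radialKernel D α₁ p τ r ≤ 4 * (2 ^ (D + 2) * 2 ^ (D + 2)) * radialKernel D α₁ q t w := by
  have hr0 : 0 < r := by linarith
  have h2D : (1 : ℝ) ≤ 2 ^ (D + 2) := one_le_rpow (by norm_num) (by linarith)
  have hA : radialKernel D α₁ p τ r ≤ 4 * r ^ (-(D + α₁)) := by
    have hpos : 0 < r ^ (-(D + α₁)) := rpow_pos_of_pos hr0 _
    unfold radialKernel
    split_ifs with h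
    · calc (τ ^ (1 / p) + r) ^ (-(D + p)) ≤ r ^ (-(D + p)) :=
            rpow_le_rpow_of_nonpos hr0 (by linarith [rpow_nonneg hτ.le (1 / p)]) (by linarith)
        _ = r ^ (-(p - α₁)) * r ^ (-(D + α₁)) := by rw [← rpow_add hr0]; ring_nf
        _ ≤ 4 * r ^ (-(D + α₁)) := by
          gcongr
          calc r ^ (-(p - α₁)) ≤ (1 / 2) ^ (-(p - α₁)) :=
                rpow_le_rpow_of_nonpos (by norm_num) hr (by linarith)
            _ = 2 ^ (p - α₁) := by
              rw [rpow_neg (by norm_num), one_div, inv_rpow (by norm_num), inv_inv]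
            _ ≤ 2 ^ (2 : ℝ) := by
              gcongr
              · norm_num
              · linarith
            _ = 4 := by norm_num
    · linarith
  have hB : r ^ (-(D + α₁)) ≤ 2 ^ (D + 2) * (2 ^ (D + 2) * radialKernel D α₁ q t w) := by
    have hmono : ∀ e : ℝ, e ≤ 2 → (2 : ℝ) ^ (D + e) ≤ 2 ^ (D + 2) := fun e he ↦ by
      gcongr
      norm_num
    have hα : α₁ ≤ 2 := hp.trans hp2
    unfold radialKernel
    split_ifs with h
    · have h3 : r ^ (-(D + α₁)) ≤ 2 ^ (D + 2) := by
        calc r ^ (-(D + α₁)) ≤ (1 / 2) ^ (-(D + α₁)) :=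
              rpow_le_rpow_of_nonpos (by norm_num) hr (by linarith)
          _ = 2 ^ (D + α₁) := by
            rw [rpow_neg (by norm_num), one_div, inv_rpow (by norm_num), inv_inv]
          _ ≤ _ := hmono _ hα
      have h4 : 1 ≤ 2 ^ (D + 2) * (t ^ (1 / q) + w) ^ (-(D + q)) := by
        have htq : 0 < t ^ (1 / q) := rpow_pos_of_pos ht _
        have htq1 : t ^ (1 / q) ≤ 1 :=
          rpow_le_one ht.le ht1 (one_div_nonneg.2 (by linarith))
        calc (1 : ℝ) = 2 ^ (D + q) * 2 ^ (-(D + q)) := by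
              rw [← rpow_add (by norm_num)]; simp
          _ ≤ _ := by
            gcongr ?_ * ?_
            · exact hmono q hq2
            · exact rpow_le_rpow_of_nonpos (by linarith) (by linarith) (by linarith)
      nlinarith
    · have hw0 : 0 < w := by linarith
      calc r ^ (-(D + α₁)) ≤ (w / 2) ^ (-(D + α₁)) :=
            rpow_le_rpow_of_nonpos (by linarith) (by linarith) (by linarith)
        _ = 2 ^ (D + α₁) * w ^ (-(D + α₁)) := by
          rw [div_rpow hw0.le (by norm_num), rpow_neg (by norm_num : (0:ℝ) ≤ 2), div_inv_eq_mul,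
            mul_comm]
        _ ≤ 2 ^ (D + 2) * w ^ (-(D + α₁)) := by
          gcongr
          · norm_num
        _ ≤ _ := by
          gcongr
          exact le_mul_of_one_le_left (by positivity) h2D
  linarith

/-- In the near regime the larger of the two shifted radii controls the shifted radius at the total
time, up to a constant. -/
lemma rpow_neg_max_le {D α₁ c b p q τ s u v w X : ℝ} (hD : 0 ≤ D) (h1 : 0 < α₁)
    (hp : α₁ ≤ p) (hp2 : p ≤ 2) (hq : α₁ ≤ q) (hq2 : q ≤ 2) (hτ : 0 < τ) (hs : 0 < s)
    (hb : 0 < b) (hc : 0 ≤ c) (hu : 0 ≤ u) (hv : 0 ≤ v) (hv1 : v ≤ 1) (hw : 0 ≤ w)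
    (hwuv : w ≤ u + v) (hpq : |p - q| ≤ c * v ^ b) (hX2 : X ≤ 2)
    (hA : τ ^ (1 / p) + u ≤ X) (hB : s ^ (1 / q) + v ≤ X) :
    X ^ (-(D + q)) ≤ ((8 * exp (c / b)) ^ (1 / α₁) + 2) ^ (D + 2) *
      ((τ + s) ^ (1 / q) + w) ^ (-(D + q)) := by
  have hp0 : 0 < p := by linarith
  have hq0 : 0 < q := by linarith
  have hτp : 0 < τ ^ (1 / p) := rpow_pos_of_pos hτ _
  have hsq : 0 < s ^ (1 / q) := rpow_pos_of_pos hs _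
  have hX : 0 < X := by linarith
  set M := 4 * exp (c / b) with hM
  have hM1 : 1 ≤ M := by
    have : 1 ≤ exp (c / b) := one_le_exp (by positivity)
    linarith
  have hMX : X ^ (-(q - p)) ≤ M := by
    apply rpow_neg_le_of_abs_le hb hc hv hv1 hX hX2 (by linarith)
    · rwa [abs_sub_comm]
    · rw [abs_le]; constructor <;> linarith
  have hτX : τ ≤ M * X ^ q := by
    calc τ = (τ ^ (1 / p)) ^ p := by rw [← rpow_mul hτ.le]; field_simp; simp
      _ ≤ X ^ p := by gcongr; linarith
      _ = X ^ (-(q - p)) * X ^ q := by rw [← rpow_add hX]; ring_nf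
      _ ≤ _ := by gcongr
  have hsX : s ≤ M * X ^ q := by
    calc s = (s ^ (1 / q)) ^ q := by rw [← rpow_mul hs.le]; field_simp; simp
      _ ≤ X ^ q := by gcongr; linarith
      _ ≤ _ := le_mul_of_one_le_left (by positivity) hM1
  have htX : (τ + s) ^ (1 / q) ≤ (2 * M) ^ (1 / α₁) * X := by
    calc (τ + s) ^ (1 / q) ≤ (2 * M * X ^ q) ^ (1 / q) := by gcongr; linarith
      _ = (2 * M) ^ (1 / q) * X := by
        rw [mul_rpow (by positivity) (by positivity), ← rpow_mul hX.le, mul_one_div_cancel hq0.ne',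
          rpow_one]
      _ ≤ _ := by
        gcongr
        linarith
  have h2M : 2 * M = 8 * exp (c / b) := by rw [hM]; ring
  rw [h2M] at htX
  set N := (8 * exp (c / b)) ^ (1 / α₁) with hN
  have hN0 : 0 < N := by positivity
  have hts : 0 < (τ + s) ^ (1 / q) := rpow_pos_of_pos (by linarith) _
  have hle : ((τ + s) ^ (1 / q) + w) ≤ (N + 2) * X := by linarith
  calc X ^ (-(D + q)) = (N + 2) ^ (D + q) * ((N + 2) * X) ^ (-(D + q)) := by
        rw [mul_rpow (by positivity) hX.le, ← mul_assoc, ← rpow_add (by positivity)]; simp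
    _ ≤ _ := by
      gcongr ?_ * ?_
      · gcongr
        linarith
      · exact rpow_le_rpow_of_nonpos (by linarith) hle (by linarith)

lemma radialKernel_le_or_le {D α₁ c b : ℝ} (hD : 0 ≤ D) (h1 : 0 < α₁) (hb : 0 < b) (hc : 0 ≤ c) :
    ∃ C > 0, ∀ p q τ s u v w : ℝ, α₁ ≤ p → p ≤ 2 → α₁ ≤ q → q ≤ 2 → 0 < τ → 0 < s → τ + s ≤ 1 →
      0 ≤ u → 0 ≤ v → 0 ≤ w → w ≤ u + v → |p - q| ≤ c * v ^ b →
      radialKernel D α₁ p τ u ≤ C * radialKernel D α₁ q (τ + s) w ∨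
        radialKernel D α₁ q s v ≤ C * radialKernel D α₁ q (τ + s) w := by
  set C₁ : ℝ := 4 * (2 ^ (D + 2) * 2 ^ (D + 2)) with hC₁
  set C₂ : ℝ := ((8 * exp (c / b)) ^ (1 / α₁) + 2) ^ (D + 2) with hC₂
  have hC₁0 : 0 < C₁ := by positivity
  have hC₂0 : 0 < C₂ := by positivity
  have he : 1 ≤ exp (c / b) := one_le_exp (by positivity)
  refine ⟨C₁ + 4 * exp (c / b) * C₂, by positivity, ?_⟩
  intro p q τ s u v w hp hp2 hq hq2 hτ hs hts hu hv hw hwuv hpq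
  have hK : 0 ≤ radialKernel D α₁ q (τ + s) w := radialKernel_nonneg (by linarith) hw
  have hle₁ : C₁ * radialKernel D α₁ q (τ + s) w ≤
      (C₁ + 4 * exp (c / b) * C₂) * radialKernel D α₁ q (τ + s) w := by
    gcongr
    linarith [mul_pos (exp_pos (c / b)) hC₂0]
  have hle₂ : 4 * exp (c / b) * (C₂ * radialKernel D α₁ q (τ + s) w) ≤
      (C₁ + 4 * exp (c / b) * C₂) * radialKernel D α₁ q (τ + s) w := by
    nlinarith
  by_cases hfar : 1 / 2 ≤ max u v
  · rcases le_total u v with huv | huv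
    · right
      rw [max_eq_right huv] at hfar
      exact (radialKernel_le_of_half_le hD h1 hq hq2 hq hq2 hs (by linarith) hts hfar hw
        (by linarith)).trans hle₁
    · left
      rw [max_eq_left huv] at hfar
      exact (radialKernel_le_of_half_le hD h1 hp hp2 hq hq2 hτ (by linarith) hts hfar hw
        (by linarith)).trans hle₁
  · rw [le_max_iff, not_or, not_le, not_le] at hfar
    have hu1 : u ≤ 1 := by linarith
    have hv1 : v ≤ 1 := by linarith
    have hw1 : w ≤ 1 := by linarith
    have hp0 : 0 < p := by linarith
    have hq0 : 0 < q := by linarith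
    have hτp : τ ^ (1 / p) ≤ 1 := rpow_le_one hτ.le (by linarith) (by positivity)
    have hsq : s ^ (1 / q) ≤ 1 := rpow_le_one hs.le (by linarith) (by positivity)
    have hτp0 : 0 < τ ^ (1 / p) := rpow_pos_of_pos hτ _
    simp only [radialKernel, if_pos hu1, if_pos hv1, if_pos hw1] at hK hle₂ ⊢
    rcases le_total (s ^ (1 / q) + v) (τ ^ (1 / p) + u) with h | h
    · left
      have hmax := rpow_neg_max_le hD h1 hp hp2 hq hq2 hτ hs hb hc hu hv hv1 hw hwuv hpq
        (by linarith) le_rfl h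
      have hA : 0 < τ ^ (1 / p) + u := by linarith
      have hswap : (τ ^ (1 / p) + u) ^ (-(p - q)) ≤ 4 * exp (c / b) := by
        apply rpow_neg_le_of_abs_le hb hc hv hv1 hA (by linarith) _ hpq
        · rw [abs_le]; constructor <;> linarith
        · linarith [rpow_nonneg hs.le (1 / q)]
      calc (τ ^ (1 / p) + u) ^ (-(D + p))
          = (τ ^ (1 / p) + u) ^ (-(p - q)) * (τ ^ (1 / p) + u) ^ (-(D + q)) := by
            rw [← rpow_add hA]; ring_nf
        _ ≤ 4 * exp (c / b) * (C₂ * ((τ + s) ^ (1 / q) + w) ^ (-(D + q))) := by gcongr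
        _ ≤ _ := hle₂
    · right
      have hmax := rpow_neg_max_le hD h1 hp hp2 hq hq2 hτ hs hb hc hu hv hv1 hw hwuv hpq
        (by linarith) h le_rfl
      refine hmax.trans (le_trans ?_ hle₂)
      exact le_mul_of_one_le_left (by positivity) (by linarith)

/-- A majorant of `min (r ^ σ) 1 * radialKernel D α₁ p τ r` uniform in the order `p ∈ [α₁, α₂]`. -/
noncomputable def radialMajorant (D α₁ α₂ σ τ r : ℝ) : ℝ :=
  if r ≤ τ ^ (1 / α₂) then τ⁻¹ * r ^ (σ - D)
  else if r ≤ 1 then r ^ (σ - D - α₂) else r ^ (-(D + α₁))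

lemma radialMajorant_nonneg {D α₁ α₂ σ τ r : ℝ} (hτ : 0 ≤ τ) (hr : 0 ≤ r) :
    0 ≤ radialMajorant D α₁ α₂ σ τ r := by
  unfold radialMajorant
  split_ifs <;> positivity

lemma min_mul_radialKernel_le {D α₁ α₂ σ p τ r : ℝ} (hD : 0 ≤ D) (h1 : 0 < α₁) (hp : α₁ ≤ p)
    (hp2 : p ≤ α₂) (hσ : 0 < σ) (hτ : 0 < τ) (hτ1 : τ ≤ 1) (hr : 0 ≤ r) :
    min (r ^ σ) 1 * radialKernel D α₁ p τ r ≤ radialMajorant D α₁ α₂ σ τ r := by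
  have hp0 : 0 < p := by linarith
  have hα₂ : 0 < α₂ := by linarith
  rcases hr.eq_or_lt with rfl | hr0
  · rw [zero_rpow hσ.ne']
    simpa using radialMajorant_nonneg hτ.le le_rfl
  have ha1 : τ ^ (1 / α₂) ≤ 1 := rpow_le_one hτ.le hτ1 (by positivity)
  have hτp : 0 < τ ^ (1 / p) := rpow_pos_of_pos hτ _
  unfold radialMajorant radialKernel
  by_cases h : r ≤ τ ^ (1 / α₂)
  · rw [if_pos h, if_pos (h.trans ha1)]
    calc min (r ^ σ) 1 * (τ ^ (1 / p) + r) ^ (-(D + p))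
        ≤ r ^ σ * ((τ ^ (1 / p) + r) ^ (-p) * (τ ^ (1 / p) + r) ^ (-D)) := by
          rw [← rpow_add (by positivity), neg_add_rev]
          gcongr
          exact min_le_left _ _
      _ ≤ r ^ σ * ((τ ^ (1 / p)) ^ (-p) * r ^ (-D)) := by
          gcongr ?_ * (?_ * ?_)
          · exact rpow_le_rpow_of_nonpos hτp (by linarith) (by linarith)
          · exact rpow_le_rpow_of_nonpos hr0 (by linarith) (by linarith)
      _ = τ⁻¹ * r ^ (σ - D) := by
          rw [← rpow_mul hτ.le, show 1 / p * -p = -1 by field_simp, rpow_neg_one, sub_eq_add_neg,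
            rpow_add hr0]
          ring
  rw [if_neg h]
  by_cases h' : r ≤ 1
  · rw [if_pos h', if_pos h']
    calc min (r ^ σ) 1 * (τ ^ (1 / p) + r) ^ (-(D + p)) ≤ r ^ σ * r ^ (-(D + α₂)) := by
          gcongr ?_ * ?_
          · exact min_le_left _ _
          · calc (τ ^ (1 / p) + r) ^ (-(D + p)) ≤ r ^ (-(D + p)) :=
                  rpow_le_rpow_of_nonpos hr0 (by linarith) (by linarith)
              _ ≤ _ := rpow_le_rpow_of_exponent_ge hr0 h' (by linarith)
      _ = r ^ (σ - D - α₂) := by rw [← rpow_add hr0]; ring_nf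
  · rw [if_neg h', if_neg h']
    exact mul_le_of_le_one_left (by positivity) (min_le_right _ _)

lemma integral_rpow_le_of_order {α₂ σ : ℝ} (hα : 0 < α₂) :
    ∃ C > 0, ∀ τ : ℝ, 0 < τ → τ ≤ 1 → ∫ y in Ioc (τ ^ (1 / α₂)) 1, y ^ (σ - 1 - α₂) ≤
      C * (τ ^ (min (σ / α₂) 1 - 1) * (1 + if σ = α₂ then |log τ| else 0)) := by
  have hval : ∀ τ : ℝ, 0 < τ → τ ≤ 1 → σ ≠ α₂ → ∫ y in Ioc (τ ^ (1 / α₂)) 1, y ^ (σ - 1 - α₂) =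
      (1 - τ ^ (σ / α₂ - 1)) / (σ - α₂) := by
    intro τ hτ hτ1 hne
    have ha0 : 0 < τ ^ (1 / α₂) := rpow_pos_of_pos hτ _
    have ha1 : τ ^ (1 / α₂) ≤ 1 := rpow_le_one hτ.le hτ1 (by positivity)
    rw [← intervalIntegral.integral_of_le ha1, integral_rpow, one_rpow, ← rpow_mul hτ.le,
      show 1 / α₂ * (σ - 1 - α₂ + 1) = σ / α₂ - 1 by field_simp; ring,
      show σ - 1 - α₂ + 1 = σ - α₂ by ring]
    right
    exact ⟨fun h ↦ hne (by linarith), notMem_uIcc_of_lt ha0 one_pos⟩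
  rcases lt_trichotomy σ α₂ with h | h | h
  · refine ⟨1 / (α₂ - σ), by have := sub_pos.2 h; positivity, fun τ hτ hτ1 ↦ ?_⟩
    rw [hval τ hτ hτ1 h.ne, if_neg h.ne, min_eq_left (by rw [div_le_one hα]; exact h.le),
      ← neg_div_neg_eq, neg_sub, neg_sub, div_mul_eq_mul_div]
    have := sub_pos.2 h
    gcongr
    linarith
  · subst h
    refine ⟨1 / σ, by positivity, fun τ hτ hτ1 ↦ ?_⟩
    have ha0 : 0 < τ ^ (1 / σ) := rpow_pos_of_pos hτ _
    have ha1 : τ ^ (1 / σ) ≤ 1 := rpow_le_one hτ.le hτ1 (by positivity)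
    have hfun : ∀ y : ℝ, y ^ (σ - 1 - σ) = y⁻¹ := fun y ↦ by
      rw [show σ - 1 - σ = -1 by ring, rpow_neg_one]
    rw [integral_congr_ae (Filter.Eventually.of_forall hfun),
      ← intervalIntegral.integral_of_le ha1, integral_inv_of_pos ha0 one_pos, one_div, log_inv,
      log_rpow hτ, if_pos rfl, div_self hα.ne', min_self, sub_self, rpow_zero, one_mul,
      ← mul_neg]
    gcongr
    linarith [neg_le_abs (log τ)]
  · refine ⟨1 / (σ - α₂), by have := sub_pos.2 h; positivity, fun τ hτ hτ1 ↦ ?_⟩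
    rw [hval τ hτ hτ1 h.ne', if_neg h.ne', min_eq_right (by rw [one_le_div hα]; exact h.le),
      sub_self, rpow_zero, div_mul_eq_mul_div]
    have := sub_pos.2 h
    gcongr
    linarith [rpow_nonneg hτ.le (σ / α₂ - 1)]

lemma integral_radialMajorant_le {d : ℕ} (hd : 1 ≤ d) {α₁ α₂ σ : ℝ} (h1 : 0 < α₁) (hα : 0 < α₂)
    (hσ : 0 < σ) :
    ∃ C > 0, ∀ τ : ℝ, 0 < τ → τ ≤ 1 →
      Integrable (fun z : EuclideanSpace ℝ (Fin d) ↦ radialMajorant d α₁ α₂ σ τ ‖z‖) ∧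
      ∫ z : EuclideanSpace ℝ (Fin d), radialMajorant d α₁ α₂ σ τ ‖z‖ ≤
        C * (τ ^ (min (σ / α₂) 1 - 1) * (1 + if σ = α₂ then |log τ| else 0)) := by
  obtain ⟨C₀, hC₀, hmid⟩ := integral_rpow_le_of_order (σ := σ) hα
  have : Nonempty (Fin d) := ⟨⟨0, hd⟩⟩
  set V := volume.real (Metric.ball (0 : EuclideanSpace ℝ (Fin d)) 1) with hV
  have hV0 : 0 ≤ V := measureReal_nonneg
  refine ⟨d * V * (1 / σ + C₀ + 1 / α₁) + 1, by positivity, fun τ hτ hτ1 ↦ ?_⟩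
  set a := τ ^ (1 / α₂) with ha
  have ha0 : 0 < a := rpow_pos_of_pos hτ _
  have ha1 : a ≤ 1 := rpow_le_one hτ.le hτ1 (by positivity)
  set F : ℝ → ℝ := fun y ↦ y ^ (d - 1) • radialMajorant d α₁ α₂ σ τ y with hF
  have hpow : ∀ y : ℝ, 0 < y → ∀ e : ℝ, y ^ (d - 1) * y ^ e = y ^ (d + e - 1) := by
    intro y hy e
    rw [← rpow_natCast, ← rpow_add hy, Nat.cast_sub hd]
    ring_nf
  have hF₁ : EqOn (fun y ↦ τ⁻¹ * y ^ (σ - 1)) F (Ioc 0 a) := by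
    intro y hy
    simp only [hF, radialMajorant, ← ha, if_pos hy.2, smul_eq_mul]
    rw [mul_left_comm, hpow y hy.1]
    ring_nf
  have hF₂ : EqOn (fun y ↦ y ^ (σ - 1 - α₂)) F (Ioc a 1) := by
    intro y hy
    simp only [hF, radialMajorant, ← ha, if_neg hy.1.not_ge, if_pos hy.2, smul_eq_mul]
    rw [hpow y (ha0.trans hy.1)]
    ring_nf
  have hF₃ : EqOn (fun y ↦ y ^ (-1 - α₁)) F (Ioi 1) := by
    intro y hy
    have hy1 : 1 < y := hy
    simp only [hF, radialMajorant, ← ha, if_neg (ha1.trans_lt hy1).not_ge, if_neg hy1.not_ge,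
      smul_eq_mul]
    rw [hpow y (by linarith)]
    ring_nf
  have hI₁ : IntegrableOn F (Ioc 0 a) := by
    refine IntegrableOn.congr_fun ?_ hF₁ measurableSet_Ioc
    refine Integrable.const_mul ?_ _
    exact (intervalIntegrable_iff_integrableOn_Ioc_of_le ha0.le).1
      (intervalIntegral.intervalIntegrable_rpow' (by linarith))
  have hI₂ : IntegrableOn F (Ioc a 1) := by
    refine IntegrableOn.congr_fun ?_ hF₂ measurableSet_Ioc
    exact (intervalIntegrable_iff_integrableOn_Ioc_of_le ha1).1
      (intervalIntegral.intervalIntegrable_rpow (Or.inr (notMem_uIcc_of_lt ha0 one_pos)))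
  have hI₃ : IntegrableOn F (Ioi 1) :=
    (integrableOn_Ioi_rpow_of_lt (by linarith) one_pos).congr_fun hF₃ measurableSet_Ioi
  have hI₂₃ : IntegrableOn F (Ioi a) := by
    rw [← Ioc_union_Ioi_eq_Ioi ha1]
    exact hI₂.union hI₃
  have hI : IntegrableOn F (Ioi 0) := by
    rw [← Ioc_union_Ioi_eq_Ioi ha0.le]
    exact hI₁.union hI₂₃
  have hJ₁ : ∫ y in Ioc 0 a, F y = τ ^ (σ / α₂ - 1) / σ := by
    rw [← setIntegral_congr_fun measurableSet_Ioc hF₁, ← intervalIntegral.integral_of_le ha0.le,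
      intervalIntegral.integral_const_mul, integral_rpow (Or.inl (by linarith)), sub_add_cancel,
      zero_rpow hσ.ne', sub_zero, ha, ← rpow_mul hτ.le, rpow_sub_one hτ.ne']
    ring_nf
  have hJ₃ : ∫ y in Ioi 1, F y = 1 / α₁ := by
    rw [← setIntegral_congr_fun measurableSet_Ioi hF₃,
      integral_Ioi_rpow_of_lt (by linarith) one_pos, one_rpow]
    rw [show -1 - α₁ + 1 = -α₁ by ring, neg_div_neg_eq]
  have hJ₂ := hmid τ hτ hτ1
  rw [← ha, setIntegral_congr_fun measurableSet_Ioc hF₂] at hJ₂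
  refine ⟨?_, ?_⟩
  · rw [integrable_fun_norm_addHaar volume (f := radialMajorant d α₁ α₂ σ τ)]
    simpa [hF] using hI
  · rw [integral_fun_norm_addHaar volume (radialMajorant d α₁ α₂ σ τ)]
    have hsum : ∫ y in Ioi (0 : ℝ), F y =
        τ ^ (σ / α₂ - 1) / σ + ((∫ y in Ioc a 1, F y) + 1 / α₁) := by
      rw [← Ioc_union_Ioi_eq_Ioi ha0.le, setIntegral_union Ioc_disjoint_Ioi_same measurableSet_Ioi
        hI₁ hI₂₃, ← Ioc_union_Ioi_eq_Ioi ha1, setIntegral_union Ioc_disjoint_Ioi_same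
        measurableSet_Ioi hI₂ hI₃, hJ₁, hJ₃]
    set L : ℝ := if σ = α₂ then |log τ| else 0 with hL
    have hL0 : 0 ≤ L := by rw [hL]; split_ifs <;> positivity
    set T := τ ^ (min (σ / α₂) 1 - 1) with hT
    have hT1 : 1 ≤ T := one_le_rpow_of_pos_of_le_one_of_nonpos hτ hτ1
      (by linarith [min_le_right (σ / α₂) 1])
    have hTσ : τ ^ (σ / α₂ - 1) ≤ T := rpow_le_rpow_of_exponent_ge hτ hτ1
      (by linarith [min_le_left (σ / α₂) 1])
    have hTL : T ≤ T * (1 + L) := le_mul_of_one_le_right (by linarith) (by linarith)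
    have hfin : Module.finrank ℝ (EuclideanSpace ℝ (Fin d)) = d := by simp
    rw [hfin, nsmul_eq_mul, smul_eq_mul, hsum]
    have hbound : τ ^ (σ / α₂ - 1) / σ + ((∫ y in Ioc a 1, F y) + 1 / α₁) ≤
        (1 / σ + C₀ + 1 / α₁) * (T * (1 + L)) := by
      have e1 : τ ^ (σ / α₂ - 1) / σ ≤ 1 / σ * (T * (1 + L)) := by
        rw [div_mul_eq_mul_div, one_mul]
        gcongr
        linarith
      have e3 : 1 / α₁ ≤ 1 / α₁ * (T * (1 + L)) :=
        le_mul_of_one_le_right (by positivity) (by linarith)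
      linarith
    have hdV : 0 ≤ (d : ℝ) * V := by positivity
    have := mul_le_mul_of_nonneg_left hbound hdV
    simp only [← mul_assoc] at this ⊢
    nlinarith

lemma min_rpow_le_add {σ u v w : ℝ} (hσ : 0 ≤ σ) (hσ1 : σ ≤ 1) (hu : 0 ≤ u) (hv : 0 ≤ v)
    (hw : 0 ≤ w) (h : u ≤ v + w) : min (u ^ σ) 1 ≤ min (v ^ σ) 1 + min (w ^ σ) 1 := by
  have hadd : u ^ σ ≤ v ^ σ + w ^ σ :=
    (rpow_le_rpow hu h hσ).trans (rpow_add_le_add_rpow hv hw hσ hσ1)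
  have hv' : 0 ≤ v ^ σ := rpow_nonneg hv σ
  have hw' : 0 ≤ w ^ σ := rpow_nonneg hw σ
  rcases min_cases (u ^ σ) 1 with h₁ | h₁ <;> rcases min_cases (v ^ σ) 1 with h₂ | h₂ <;>
    rcases min_cases (w ^ σ) 1 with h₃ | h₃ <;> linarith

lemma min_rpow_mul_min_rpow {a b v : ℝ} (ha : 0 < a) (hb : 0 < b) (hv : 0 ≤ v) :
    min (v ^ a) 1 * min (v ^ b) 1 = min (v ^ (a + b)) 1 := by
  rcases le_total v 1 with h | h
  · rw [min_eq_left (rpow_le_one hv h ha.le), min_eq_left (rpow_le_one hv h hb.le),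
      min_eq_left (rpow_le_one hv h (by linarith)), rpow_add_of_nonneg hv ha.le hb.le]
  · rw [min_eq_right (one_le_rpow h ha.le), min_eq_right (one_le_rpow h hb.le),
      min_eq_right (one_le_rpow h (by linarith)), one_mul]

/-- Moving one of two weights to the endpoint distance `w`. -/
lemma min_mul_min_mul_radialKernel_le {D α₁ α₂ σ σ' p τ u v w : ℝ} (hD : 0 ≤ D) (h1 : 0 < α₁)
    (hp : α₁ ≤ p) (hp2 : p ≤ α₂) (hσ : 0 < σ) (hσ' : 0 < σ') (hσ1 : σ' ≤ 1) (hτ : 0 < τ)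
    (hτ1 : τ ≤ 1) (hu : 0 ≤ u) (hv : 0 ≤ v) (hw : 0 ≤ w) (h : v ≤ u + w) :
    min (v ^ σ') 1 * (min (u ^ σ) 1 * radialKernel D α₁ p τ u) ≤
      radialMajorant D α₁ α₂ (σ + σ') τ u + min (w ^ σ') 1 * radialMajorant D α₁ α₂ σ τ u := by
  have hK : 0 ≤ radialKernel D α₁ p τ u := radialKernel_nonneg hτ.le hu
  have hG := min_mul_radialKernel_le hD h1 hp hp2 hσ hτ hτ1 hu
  have hG' := min_mul_radialKernel_le hD h1 hp hp2 (add_pos hσ hσ') hτ hτ1 hu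
  rw [← min_rpow_mul_min_rpow hσ hσ' hu] at hG'
  have hm := min_rpow_le_add hσ'.le hσ1 hv hu hw h
  calc min (v ^ σ') 1 * (min (u ^ σ) 1 * radialKernel D α₁ p τ u)
      ≤ (min (u ^ σ') 1 + min (w ^ σ') 1) * (min (u ^ σ) 1 * radialKernel D α₁ p τ u) := by
        gcongr
    _ = min (u ^ σ) 1 * min (u ^ σ') 1 * radialKernel D α₁ p τ u +
        min (w ^ σ') 1 * (min (u ^ σ) 1 * radialKernel D α₁ p τ u) := by ring
    _ ≤ _ := by gcongr

theorem stmt11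
    (d : ℕ) (hd : 1 ≤ d)
    (α₁ α₂ : ℝ) (h1 : 0 < α₁) (h12 : α₁ ≤ α₂) (h2 : α₂ < 2)
    (α : EuclideanSpace ℝ (Fin d) → ℝ) (hαm : Measurable α)
    (hαb : ∀ x, α x ∈ Icc α₁ α₂)
    (c₁ β₁ : ℝ) (hc₁ : 0 < c₁) (hβ₁ : β₁ ∈ Ioc (0:ℝ) 1)
    (hαH : ∀ x y, |α x - α y| ≤ c₁ * min (‖x - y‖ ^ β₁) 1)
    (θ₁ θ₂ : ℝ) (σ₁ σ₂ : ℝ) (hσ₁ : σ₁ ∈ Ioo (0:ℝ) 1) (hσ₂ : σ₂ ∈ Ioo (0:ℝ) 1) :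
    ∃ C > 0, ∀ s t : ℝ, 0 < s → s < t → t ≤ 1 → ∀ x y : EuclideanSpace ℝ (Fin d),
      (∫⁻ z, ENNReal.ofReal
          (rho d α α₁ θ₁ z σ₁ (t - s) (x - z) * rho d α α₁ θ₂ y σ₂ s (z - y)))
        ≤ ENNReal.ofReal (C *
          (((t - s) ^ (θ₁ + min ((σ₁ + σ₂) / α₂) 1 - 1) * s ^ θ₂ *
              (1 + if σ₁ + σ₂ = α₂ then |Real.log (t - s)| else 0)
            + (t - s) ^ θ₁ * s ^ (θ₂ + min ((σ₁ + σ₂) / α₂) 1 - 1) *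
              (1 + if σ₁ + σ₂ = α₂ then |Real.log s| else 0)) *
            rho d α α₁ 0 y 0 t (x - y)
          + (t - s) ^ (θ₁ + min (σ₁ / α₂) 1 - 1) * s ^ θ₂ *
              (1 + if σ₁ = α₂ then |Real.log (t - s)| else 0) *
            rho d α α₁ 0 y σ₂ t (x - y)
          + (t - s) ^ θ₁ * s ^ (θ₂ + min (σ₂ / α₂) 1 - 1) *
              (1 + if σ₂ = α₂ then |Real.log s| else 0) *
            rho d α α₁ 0 y σ₁ t (x - y))) := by
  have hα₂ : 0 < α₂ := h1.trans_le h12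
  have hd0 : (0 : ℝ) ≤ d := d.cast_nonneg
  obtain ⟨C₀, hC₀, hdich⟩ := radialKernel_le_or_le hd0 h1 hβ₁.1 hc₁.le
  obtain ⟨C₁, hC₁, hmaj₁⟩ := integral_radialMajorant_le hd h1 hα₂ hσ₁.1
  obtain ⟨C₂, hC₂, hmaj₂⟩ := integral_radialMajorant_le hd h1 hα₂ hσ₂.1
  obtain ⟨C₃, hC₃, hmaj₃⟩ := integral_radialMajorant_le hd h1 hα₂ (add_pos hσ₁.1 hσ₂.1)
  refine ⟨C₀ * (C₁ + C₂ + C₃), by positivity, fun s t hs hst ht x y ↦ ?_⟩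
  obtain ⟨τ, rfl⟩ : ∃ τ, t = τ + s := ⟨t - s, by ring⟩
  rw [add_sub_cancel_right]
  have hτ : 0 < τ := by linarith
  have hτ1 : τ ≤ 1 := by linarith
  have hs1 : s ≤ 1 := by linarith
  set w := ‖x - y‖ with hw
  have hw0 : 0 ≤ w := norm_nonneg _
  set Kw := radialKernel d α₁ (α y) (τ + s) w with hKw
  have hKw0 : 0 ≤ Kw := radialKernel_nonneg (by linarith) hw0
  have hrhow : ∀ σ : ℝ, rho d α α₁ 0 y σ (τ + s) (x - y) = min (w ^ σ) 1 * Kw := fun σ ↦ by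
    simp [rho, radialKernel, hKw, hw]
  set G : ℝ → ℝ → ℝ → ℝ := radialMajorant d α₁ α₂ with hG
  set P := τ ^ θ₁ * s ^ θ₂ with hP
  have hP0 : 0 ≤ P := by positivity
  have hpt : ∀ z, rho d α α₁ θ₁ z σ₁ τ (x - z) * rho d α α₁ θ₂ y σ₂ s (z - y) ≤
      P * (C₀ * Kw) * ((G (σ₁ + σ₂) τ ‖x - z‖ + min (w ^ σ₂) 1 * G σ₁ τ ‖x - z‖) +
        (G (σ₁ + σ₂) s ‖z - y‖ + min (w ^ σ₁) 1 * G σ₂ s ‖z - y‖)) := by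
    intro z
    set u := ‖x - z‖ with hu
    set v := ‖z - y‖ with hv
    have hu0 : 0 ≤ u := norm_nonneg _
    have hv0 : 0 ≤ v := norm_nonneg _
    have hwuv : w ≤ u + v := norm_sub_le_norm_sub_add_norm_sub x z y
    have huvw : u ≤ v + w := by
      have := norm_sub_le_norm_sub_add_norm_sub x y z
      rw [norm_sub_rev y z] at this
      linarith
    have hvuw : v ≤ u + w := by
      have := norm_sub_le_norm_sub_add_norm_sub z x y
      rw [norm_sub_rev z x] at this
      linarith
    have hpq : |α z - α y| ≤ c₁ * v ^ β₁ :=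
      (hαH z y).trans (by gcongr; exact min_le_left _ _)
    have hKu : 0 ≤ radialKernel d α₁ (α z) τ u := radialKernel_nonneg hτ.le hu0
    have hKv : 0 ≤ radialKernel d α₁ (α y) s v := radialKernel_nonneg hs.le hv0
    have hGu : ∀ σ, 0 ≤ G σ τ u := fun σ ↦ radialMajorant_nonneg hτ.le hu0
    have hGv : ∀ σ, 0 ≤ G σ s v := fun σ ↦ radialMajorant_nonneg hs.le hv0
    have hmu := min_mul_min_mul_radialKernel_le (w := w) hd0 h1 (hαb z).1 (hαb z).2 hσ₁.1 hσ₂.1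
      hσ₂.2.le hτ hτ1 hu0 hv0 hw0 hvuw
    have hmv := min_mul_min_mul_radialKernel_le (w := w) hd0 h1 (hαb y).1 (hαb y).2 hσ₂.1 hσ₁.1
      hσ₁.2.le hs hs1 hv0 hu0 hw0 huvw
    rw [add_comm σ₂ σ₁] at hmv
    have hmain : (min (u ^ σ₁) 1 * radialKernel d α₁ (α z) τ u) *
        (min (v ^ σ₂) 1 * radialKernel d α₁ (α y) s v) ≤
        C₀ * Kw * ((G (σ₁ + σ₂) τ u + min (w ^ σ₂) 1 * G σ₁ τ u) +
          (G (σ₁ + σ₂) s v + min (w ^ σ₁) 1 * G σ₂ s v)) := by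
      have hSu : 0 ≤ G (σ₁ + σ₂) τ u + min (w ^ σ₂) 1 * G σ₁ τ u :=
        add_nonneg (hGu _) (mul_nonneg (by positivity) (hGu _))
      have hSv : 0 ≤ G (σ₁ + σ₂) s v + min (w ^ σ₁) 1 * G σ₂ s v :=
        add_nonneg (hGv _) (mul_nonneg (by positivity) (hGv _))
      rcases hdich (α z) (α y) τ s u v w (hαb z).1 ((hαb z).2.trans h2.le) (hαb y).1
        ((hαb y).2.trans h2.le) hτ hs ht hu0 hv0 hw0 hwuv hpq with h | h
      · calc (min (u ^ σ₁) 1 * radialKernel d α₁ (α z) τ u) *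
              (min (v ^ σ₂) 1 * radialKernel d α₁ (α y) s v)
            = radialKernel d α₁ (α z) τ u *
              (min (u ^ σ₁) 1 * (min (v ^ σ₂) 1 * radialKernel d α₁ (α y) s v)) := by ring
          _ ≤ C₀ * Kw * (G (σ₁ + σ₂) s v + min (w ^ σ₁) 1 * G σ₂ s v) := by gcongr
          _ ≤ _ := mul_le_mul_of_nonneg_left (by linarith) (by positivity)
      · calc (min (u ^ σ₁) 1 * radialKernel d α₁ (α z) τ u) *
              (min (v ^ σ₂) 1 * radialKernel d α₁ (α y) s v)
            = radialKernel d α₁ (α y) s v *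
              (min (v ^ σ₂) 1 * (min (u ^ σ₁) 1 * radialKernel d α₁ (α z) τ u)) := by ring
          _ ≤ C₀ * Kw * (G (σ₁ + σ₂) τ u + min (w ^ σ₂) 1 * G σ₁ τ u) := by gcongr
          _ ≤ _ := mul_le_mul_of_nonneg_left (by linarith) (by positivity)
    calc rho d α α₁ θ₁ z σ₁ τ (x - z) * rho d α α₁ θ₂ y σ₂ s (z - y)
        = P * ((min (u ^ σ₁) 1 * radialKernel d α₁ (α z) τ u) *
          (min (v ^ σ₂) 1 * radialKernel d α₁ (α y) s v)) := by
          simp only [rho, radialKernel, hP, hu, hv]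
          ring
      _ ≤ P * (C₀ * Kw * _) := mul_le_mul_of_nonneg_left hmain hP0
      _ = _ := by ring
  have iu₃ := (hmaj₃ τ hτ hτ1).1.comp_sub_left x
  have iu₁ := (hmaj₁ τ hτ hτ1).1.comp_sub_left x
  have iv₃ := (hmaj₃ s hs hs1).1.comp_sub_right y
  have iv₂ := (hmaj₂ s hs hs1).1.comp_sub_right y
  have iu := iu₃.fun_add (iu₁.const_mul (min (w ^ σ₂) 1))
  have iv := iv₃.fun_add (iv₂.const_mul (min (w ^ σ₁) 1))
  have hI := (iu.fun_add iv).const_mul (P * (C₀ * Kw))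
  refine (lintegral_mono fun z ↦ ENNReal.ofReal_le_ofReal (hpt z)).trans ?_
  rw [← ofReal_integral_eq_lintegral_ofReal hI]
  swap
  · refine Filter.Eventually.of_forall fun z ↦ ?_
    have hGu : ∀ σ, 0 ≤ G σ τ ‖x - z‖ := fun σ ↦ radialMajorant_nonneg hτ.le (norm_nonneg _)
    have hGv : ∀ σ, 0 ≤ G σ s ‖z - y‖ := fun σ ↦ radialMajorant_nonneg hs.le (norm_nonneg _)
    exact mul_nonneg (by positivity) (add_nonneg
      (add_nonneg (hGu _) (mul_nonneg (by positivity) (hGu _)))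
      (add_nonneg (hGv _) (mul_nonneg (by positivity) (hGv _))))
  refine ENNReal.ofReal_le_ofReal ?_
  have hsplit : ∫ z, P * (C₀ * Kw) *
      ((G (σ₁ + σ₂) τ ‖x - z‖ + min (w ^ σ₂) 1 * G σ₁ τ ‖x - z‖) +
        (G (σ₁ + σ₂) s ‖z - y‖ + min (w ^ σ₁) 1 * G σ₂ s ‖z - y‖)) =
      P * (C₀ * Kw) * (((∫ z : EuclideanSpace ℝ (Fin d), G (σ₁ + σ₂) τ ‖z‖) +
        min (w ^ σ₂) 1 * ∫ z : EuclideanSpace ℝ (Fin d), G σ₁ τ ‖z‖) +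
        ((∫ z : EuclideanSpace ℝ (Fin d), G (σ₁ + σ₂) s ‖z‖) +
        min (w ^ σ₁) 1 * ∫ z : EuclideanSpace ℝ (Fin d), G σ₂ s ‖z‖)) := by
    rw [integral_const_mul, integral_add iu iv, integral_add iu₃ (iu₁.const_mul _),
      integral_add iv₃ (iv₂.const_mul _),
      integral_const_mul, integral_const_mul,
      integral_sub_left_eq_self (fun z ↦ G (σ₁ + σ₂) τ ‖z‖) volume x,
      integral_sub_left_eq_self (fun z ↦ G σ₁ τ ‖z‖) volume x,
      integral_sub_right_eq_self (fun z ↦ G (σ₁ + σ₂) s ‖z‖) y,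
      integral_sub_right_eq_self (fun z ↦ G σ₂ s ‖z‖) y]
  refine hsplit.trans_le ?_
  have hpow : ∀ r : ℝ, 0 < r → ∀ θ e : ℝ, r ^ (θ + e - 1) = r ^ θ * r ^ (e - 1) :=
    fun r hr θ e ↦ by rw [add_sub_assoc, rpow_add hr]
  rw [hrhow, hrhow, hrhow, rpow_zero, min_self, one_mul, hpow τ hτ, hpow τ hτ, hpow s hs,
    hpow s hs]
  have bu₃ := (hmaj₃ τ hτ hτ1).2
  have bu₁ := (hmaj₁ τ hτ hτ1).2
  have bv₃ := (hmaj₃ s hs hs1).2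
  have bv₂ := (hmaj₂ s hs hs1).2
  have hlog : ∀ σ r : ℝ, 0 ≤ 1 + if σ = α₂ then |log r| else 0 := fun σ r ↦ by
    split_ifs <;> positivity
  have hX₃ := mul_nonneg (rpow_nonneg hτ.le (min ((σ₁ + σ₂) / α₂) 1 - 1)) (hlog (σ₁ + σ₂) τ)
  have hX₁ := mul_nonneg (rpow_nonneg hτ.le (min (σ₁ / α₂) 1 - 1)) (hlog σ₁ τ)
  have hY₃ := mul_nonneg (rpow_nonneg hs.le (min ((σ₁ + σ₂) / α₂) 1 - 1)) (hlog (σ₁ + σ₂) s)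
  have hY₂ := mul_nonneg (rpow_nonneg hs.le (min (σ₂ / α₂) 1 - 1)) (hlog σ₂ s)
  have hC₁' : C₁ ≤ C₁ + C₂ + C₃ := by linarith
  have hC₂' : C₂ ≤ C₁ + C₂ + C₃ := by linarith
  have hC₃' : C₃ ≤ C₁ + C₂ + C₃ := by linarith
  replace bu₃ := bu₃.trans (mul_le_mul_of_nonneg_right hC₃' hX₃)
  replace bu₁ := bu₁.trans (mul_le_mul_of_nonneg_right hC₁' hX₁)
  replace bv₃ := bv₃.trans (mul_le_mul_of_nonneg_right hC₃' hY₃)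
  replace bv₂ := bv₂.trans (mul_le_mul_of_nonneg_right hC₂' hY₂)
  refine (mul_le_mul_of_nonneg_left (add_le_add
    (add_le_add bu₃ (mul_le_mul_of_nonneg_left bu₁ (by positivity)))
    (add_le_add bv₃ (mul_le_mul_of_nonneg_left bv₂ (by positivity)))) (by positivity)).trans_eq ?_
  rw [hP]
  ring
end

section
/- For every θ₁, θ₂ ∈ ℝ and σ₁, σ₂ ∈ (0,1) with θ₁ + σ₁/α₂ > 0 and θ₂ + σ₂/α₂ > 0, there exists a constant c > 0 such that for all t ∈ (0,1] and all x, y ∈ ℝ^d satisfying σ₁ + σ₂ < min(α(x), α(y)), θ₁ + σ₁/α(x) > 0 and θ₂ + σ₂/α(y) > 0: ∫₀ᵗ ∫_{ℝ^d} ρ_{θ₁}^{z,σ₁}(t−s, x−z) ρ_{θ₂}^{y,σ₂}(s, z−y) dz ds ≤ c · B(σ₁/α₂ + θ₁, σ₂/α₂ + θ₂) · [ ρ_{θ₁+θ₂+(σ₁+σ₂)/α*(x,y)}^{y,0}(t, x−y) + ρ_{θ₁+θ₂+σ₁/α(x)}^{y,σ₂}(t, x−y) + ρ_{θ₁+θ₂+σ₂/α(y)}^{y,σ₁}(t,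 x−y) ], where α*(x,y) = max(α(x), α(y)) and B denotes the Beta function. -/
open MeasureTheory Real Set

/-- The Beta function `B(a,b) = Γ(a)Γ(b)/Γ(a+b)`. -/
noncomputable def betaFn (a b : ℝ) : ℝ :=
  Real.Gamma a * Real.Gamma b / Real.Gamma (a + b)

/-- The space-time profile of `rho`, as a function of the radius. -/
noncomputable def ker (D α₁ a σ t r : ℝ) : ℝ :=
  min (r ^ σ) 1 * (if r ≤ 1 then (t ^ (1 / a) + r) ^ (-(D + a)) else r ^ (-(D + α₁)))

/-- The limiting profile of `ker` at radii that are large compared with `t ^ (1 / a)`. -/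
noncomputable def tail (D α₁ a σ r : ℝ) : ℝ :=
  if r ≤ 1 then r ^ (-(D + a - σ)) else r ^ (-(D + α₁))

theorem rho_eq_ker (d : ℕ) (α : EuclideanSpace ℝ (Fin d) → ℝ) (α₁ γ : ℝ)
    (y : EuclideanSpace ℝ (Fin d)) (β t : ℝ) (x : EuclideanSpace ℝ (Fin d)) :
    rho d α α₁ γ y β t x = t ^ γ * ker d α₁ (α y) β t ‖x‖ := by
  simp only [rho, ker, mul_assoc]

theorem ker_nonneg {D α₁ a σ t r : ℝ} (ht : 0 ≤ t) (hr : 0 ≤ r) : 0 ≤ ker D α₁ a σ t r := by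
  unfold ker
  split_ifs <;> positivity

theorem tail_nonneg {D α₁ a σ r : ℝ} (hr : 0 ≤ r) : 0 ≤ tail D α₁ a σ r := by
  unfold tail
  split_ifs <;> positivity

/-- Powers whose exponent is small compared with `r ^ β` are bounded near `r = 0`. -/
theorem rpow_le_exp_of_abs_le {r β κ e : ℝ} (hr : 0 < r) (hr1 : r ≤ 1) (hβ : 0 < β)
    (hκ : 0 ≤ κ) (he : |e| ≤ κ * r ^ β) : r ^ e ≤ exp (κ / β) := by
  rw [rpow_def_of_pos hr, exp_le_exp]
  have hlog : log r ≤ 0 := log_nonpos hr.le hr1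
  have h1 : log r * e ≤ -log r * (κ * r ^ β) := by
    calc log r * e ≤ |log r * e| := le_abs_self _
      _ = -log r * |e| := by rw [abs_mul, abs_of_nonpos hlog]
      _ ≤ _ := mul_le_mul_of_nonneg_left he (by linarith)
  have h2 : -log r * β * r ^ β ≤ 1 := by
    have h3 : -log r * β ≤ exp (-log r * β) := by linarith [add_one_le_exp (-log r * β)]
    have h4 : r ^ β = exp (-(-log r * β)) := by rw [rpow_def_of_pos hr]; congr 1; ring
    rw [h4]
    calc _ ≤ exp (-log r * β) * exp (-(-log r * β)) :=
          mul_le_mul_of_nonneg_right h3 (exp_pos _).le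
      _ = 1 := by rw [← exp_add]; simp
  rw [le_div_iff₀ hβ]
  calc log r * e * β ≤ -log r * (κ * r ^ β) * β := mul_le_mul_of_nonneg_right h1 hβ.le
    _ = κ * (-log r * β * r ^ β) := by ring
    _ ≤ κ * 1 := mul_le_mul_of_nonneg_left h2 hκ
    _ = κ := mul_one _

theorem rpow_le_const_mul_rpow {r β κ p q : ℝ} (hr : 0 < r) (hr1 : r ≤ 1) (hβ : 0 < β)
    (hκ : 0 ≤ κ) (h : |p - q| ≤ κ * r ^ β) : r ^ p ≤ exp (κ / β) * r ^ q := by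
  have : r ^ p = r ^ (p - q) * r ^ q := by rw [← rpow_add hr]; ring_nf
  rw [this]
  exact mul_le_mul_of_nonneg_right (rpow_le_exp_of_abs_le hr hr1 hβ hκ h) (by positivity)

/-- Below the parabolic scale, the powers of time attached to two nearby indices agree. -/
theorem time_rpow_le_const_mul {D α₁ κ β p q r t : ℝ} (hD : 0 ≤ D) (h1 : 0 < α₁)
    (hp : α₁ ≤ p) (hq : α₁ ≤ q) (hq2 : q ≤ 2) (hβ : 0 < β) (hκ : 0 ≤ κ)
    (hr : 0 ≤ r) (ht : 0 < t) (ht1 : t ≤ 1) (hrt : r ≤ t ^ (1 / q))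
    (h : |p - q| ≤ κ * r ^ β) {e₁ e₂ : ℝ} (he : |e₁ - e₂| ≤ D * |1 / p - 1 / q|) :
    t ^ e₁ ≤ exp (D * κ / α₁ ^ 2 / (β / 2)) * t ^ e₂ := by
  have hp0 : 0 < p := h1.trans_le hp
  have hq0 : 0 < q := h1.trans_le hq
  apply rpow_le_const_mul_rpow ht ht1 (by positivity) (by positivity)
  have h2 : |1 / p - 1 / q| ≤ |p - q| / α₁ ^ 2 := by
    have : 1 / p - 1 / q = (q - p) / (p * q) := by field_simp
    rw [this, abs_div, abs_sub_comm q p, abs_of_pos (mul_pos hp0 hq0)]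
    apply div_le_div_of_nonneg_left (abs_nonneg _) (by positivity)
    nlinarith
  have h3 : r ^ β ≤ t ^ (β / 2) := by
    calc r ^ β ≤ (t ^ (1 / q)) ^ β := rpow_le_rpow hr hrt hβ.le
      _ = t ^ (1 / q * β) := by rw [← rpow_mul ht.le]
      _ ≤ t ^ (β / 2) := by
        apply rpow_le_rpow_of_exponent_ge ht ht1
        rw [one_div, inv_mul_eq_div]
        exact div_le_div_of_nonneg_left hβ.le hq0 hq2
  calc |e₁ - e₂| ≤ D * |1 / p - 1 / q| := he
    _ ≤ D * (κ * t ^ (β / 2) / α₁ ^ 2) := by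
      gcongr
      exact h2.trans (by gcongr; exact h.trans (by gcongr))
    _ = _ := by ring

theorem add_rpow_le_two_rpow {u v k M : ℝ} (hu : 0 ≤ u) (hv : 0 ≤ v) (hk : 0 ≤ k) (hM : k ≤ M) :
    (u + v) ^ k ≤ 2 ^ M * max (u ^ k) (v ^ k) := by
  have h2 : (2 : ℝ) ^ k ≤ 2 ^ M := rpow_le_rpow_of_exponent_le (by norm_num) hM
  have key : (u + v) ^ k ≤ 2 ^ k * max (u ^ k) (v ^ k) := by
    rcases le_total u v with h | h
    · calc (u + v) ^ k ≤ (2 * v) ^ k := rpow_le_rpow (by positivity) (by linarith) hk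
        _ = 2 ^ k * v ^ k := mul_rpow (by norm_num) hv
        _ ≤ _ := by gcongr; exact le_max_right _ _
    · calc (u + v) ^ k ≤ (2 * u) ^ k := rpow_le_rpow (by positivity) (by linarith) hk
        _ = 2 ^ k * u ^ k := mul_rpow (by norm_num) hu
        _ ≤ _ := by gcongr; exact le_max_left _ _
  exact key.trans (by gcongr)

/-- Replacing the index by a nearby one changes the kernel only by a bounded factor. -/
theorem exists_ker_le_const_mul {D α₁ κ β : ℝ} (hD : 0 ≤ D) (h1 : 0 < α₁) (hβ : 0 < β)
    (hκ : 0 ≤ κ) : ∃ C > 0, ∀ p q σ r t : ℝ, α₁ ≤ p → α₁ ≤ q → q ≤ 2 →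
      0 ≤ r → 0 < t → t ≤ 1 → |p - q| ≤ κ * r ^ β →
      ker D α₁ p σ t r ≤ C * ker D α₁ q σ t r := by
  set A := exp (κ / β) with hA
  set B := exp (D * κ / α₁ ^ 2 / (β / 2)) with hB
  have hA1 : 1 ≤ A := one_le_exp (by positivity)
  have hB1 : 1 ≤ B := one_le_exp (by positivity)
  refine ⟨2 ^ (D + 2) * (A * B), by positivity, ?_⟩
  intro p q σ r t hp hq hq2 hr ht ht1 h
  have hp0 : 0 < p := h1.trans_le hp
  have hq0 : 0 < q := h1.trans_le hq
  have h2 : (1 : ℝ) ≤ 2 ^ (D + 2) := one_le_rpow (by norm_num) (by positivity)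
  have hC : 1 ≤ 2 ^ (D + 2) * (A * B) := one_le_mul_of_one_le_of_one_le h2
    (one_le_mul_of_one_le_of_one_le hA1 hB1)
  unfold ker
  have hm : 0 ≤ min (r ^ σ) 1 := by positivity
  rw [mul_left_comm]
  refine mul_le_mul_of_nonneg_left ?_ hm
  split_ifs with hr1
  · have tp : 0 < t ^ (1 / p) := by positivity
    have tq : 0 < t ^ (1 / q) := by positivity
    rw [rpow_neg (by positivity), rpow_neg (by positivity), ← div_eq_mul_inv,
      inv_eq_one_div, div_le_div_iff₀ (by positivity) (by positivity), one_mul]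
    have hsp : r ^ (D + q) ≤ A * (t ^ (1 / p) + r) ^ (D + p) := by
      rcases hr.eq_or_lt with h0 | h0
      · rw [← h0, zero_rpow (by positivity)]; positivity
      calc r ^ (D + q) ≤ A * r ^ (D + p) := by
            apply rpow_le_const_mul_rpow h0 hr1 hβ hκ
            rw [add_sub_add_left_eq_sub, abs_sub_comm]; exact h
        _ ≤ _ := by
            gcongr; linarith
    refine (add_rpow_le_two_rpow tq.le hr (by positivity)
      (by linarith : D + q ≤ D + 2)).trans ?_
    rw [mul_assoc]
    refine mul_le_mul_of_nonneg_left ?_ (by positivity)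
    have hAB : A ≤ A * B := le_mul_of_one_le_right (by positivity) hB1
    have hBA : B ≤ A * B := le_mul_of_one_le_left (by positivity) hA1
    refine max_le ?_ (hsp.trans (by gcongr))
    rcases le_total r (t ^ (1 / q)) with hc | hc
    · calc (t ^ (1 / q)) ^ (D + q) = t ^ (1 / q * (D + q)) := by rw [← rpow_mul ht.le]
        _ ≤ B * t ^ (1 / p * (D + p)) := by
            apply time_rpow_le_const_mul hD h1 hp hq hq2 hβ hκ hr ht ht1 hc h
            have : 1 / q * (D + q) - 1 / p * (D + p) = D * (1 / q - 1 / p) := by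
              field_simp; ring
            rw [this, abs_mul, abs_of_nonneg hD, abs_sub_comm]
        _ = B * (t ^ (1 / p)) ^ (D + p) := by rw [← rpow_mul ht.le]
        _ ≤ A * B * (t ^ (1 / p) + r) ^ (D + p) := by
            gcongr; linarith
    · calc (t ^ (1 / q)) ^ (D + q) ≤ r ^ (D + q) := by gcongr
        _ ≤ A * (t ^ (1 / p) + r) ^ (D + p) := hsp
        _ ≤ _ := by gcongr
  · exact le_mul_of_one_le_left (by positivity) hC

theorem min_rpow_eq {r σ : ℝ} (hr : 0 ≤ r) (hσ : 0 ≤ σ) (h : r ≤ 1) : min (r ^ σ) 1 = r ^ σ :=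
  min_eq_left (rpow_le_one hr h hσ)

theorem ker_le_add_rpow {D α₁ a σ t r : ℝ} (hσ : 0 ≤ σ)
    (hr : 0 ≤ r) (hr1 : r ≤ 1) (ht : 0 < t) :
    ker D α₁ a σ t r ≤ (t ^ (1 / a) + r) ^ (-(D + a - σ)) := by
  have tp : 0 < t ^ (1 / a) := by positivity
  rw [ker, if_pos hr1, min_rpow_eq hr hσ hr1]
  calc r ^ σ * (t ^ (1 / a) + r) ^ (-(D + a))
      ≤ (t ^ (1 / a) + r) ^ σ * (t ^ (1 / a) + r) ^ (-(D + a)) := by gcongr; linarith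
    _ = _ := by rw [← rpow_add (by positivity)]; ring_nf

theorem ker_le_rpow_of_one_lt {D α₁ a σ t r : ℝ} (hr : 1 < r) :
    ker D α₁ a σ t r ≤ r ^ (-(D + α₁)) := by
  rw [ker, if_neg hr.not_ge]
  exact mul_le_of_le_one_left (by positivity) (min_le_right _ _)

theorem ker_le_time {D α₁ a σ t r : ℝ} (h1 : 0 < α₁) (ha : 0 < a) (hD : 0 ≤ D) (hσ : 0 ≤ σ)
    (hσa : σ ≤ a) (hr : 0 ≤ r) (ht : 0 < t) (ht1 : t ≤ 1) :
    ker D α₁ a σ t r ≤ t ^ ((σ - D - a) / a) := by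
  have tp : 0 < t ^ (1 / a) := by positivity
  rcases le_or_gt r 1 with hr1 | hr1
  · refine (ker_le_add_rpow hσ hr hr1 ht).trans ?_
    calc _ ≤ (t ^ (1 / a)) ^ (-(D + a - σ)) :=
          rpow_le_rpow_of_nonpos tp (by linarith) (by linarith)
      _ = _ := by rw [← rpow_mul ht.le]; congr 1; ring
  · calc _ ≤ r ^ (-(D + α₁)) := ker_le_rpow_of_one_lt hr1
      _ ≤ 1 := rpow_le_one_of_one_le_of_nonpos hr1.le (by linarith)
      _ ≤ _ := one_le_rpow_of_pos_of_le_one_of_nonpos ht ht1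
        (div_nonpos_of_nonpos_of_nonneg (by linarith) ha.le)

theorem ker_le_tail {D α₁ a σ t r : ℝ} (hD : 0 ≤ D) (hσ : 0 ≤ σ)
    (hσa : σ ≤ a) (hr : 0 < r) (ht : 0 < t) :
    ker D α₁ a σ t r ≤ tail D α₁ a σ r := by
  have tp : 0 < t ^ (1 / a) := by positivity
  rw [tail]
  split_ifs with hr1
  · exact (ker_le_add_rpow hσ hr.le hr1 ht).trans
      (rpow_le_rpow_of_nonpos hr (by linarith) (by linarith))
  · exact ker_le_rpow_of_one_lt (not_le.1 hr1)

theorem tail_le_const_mul_ker {D α₁ a σ t r : ℝ} (hD : 0 ≤ D) (hσ : 0 ≤ σ) (ha : 0 < a)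
    (ha2 : a ≤ 2) (ht : 0 < t) (hrt : t ^ (1 / a) ≤ r) :
    tail D α₁ a σ r ≤ 2 ^ (D + 2) * ker D α₁ a σ t r := by
  have tp : 0 < t ^ (1 / a) := by positivity
  have hr : 0 < r := tp.trans_le hrt
  have h2 : (1 : ℝ) ≤ 2 ^ (D + 2) := one_le_rpow (by norm_num) (by positivity)
  rw [tail, ker]
  split_ifs with hr1
  · rw [min_rpow_eq hr.le hσ hr1, mul_left_comm]
    have : r ^ (-(D + a - σ)) = r ^ σ * r ^ (-(D + a)) := by rw [← rpow_add hr]; ring_nf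
    rw [this]
    refine mul_le_mul_of_nonneg_left ?_ (by positivity)
    calc r ^ (-(D + a)) = 2 ^ (D + a) * (2 * r) ^ (-(D + a)) := by
          rw [mul_rpow (by norm_num) hr.le, ← mul_assoc, ← rpow_add (by norm_num)]; simp
      _ ≤ 2 ^ (D + 2) * (t ^ (1 / a) + r) ^ (-(D + a)) := by
          refine mul_le_mul (rpow_le_rpow_of_exponent_le (by norm_num) (by linarith))
            (rpow_le_rpow_of_nonpos (by positivity) (by linarith) (by linarith))
            (by positivity) (by positivity)
  · rw [min_eq_right (one_le_rpow (not_le.1 hr1).le hσ), one_mul]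
    exact le_mul_of_one_le_left (by positivity) h2

theorem time_rpow_le_const_mul_ker {D α₁ a t r : ℝ} (hD : 0 ≤ D) (ha : 0 < a)
    (ha2 : a ≤ 2) (ht : 0 < t) (ht1 : t ≤ 1) (hr : 0 ≤ r) (hrt : r ≤ t ^ (1 / a)) :
    t ^ (-(D + a) / a) ≤ 2 ^ (D + 2) * ker D α₁ a 0 t r := by
  have tp : 0 < t ^ (1 / a) := by positivity
  have hr1 : r ≤ 1 := hrt.trans (rpow_le_one ht.le ht1 (by positivity))
  rw [ker, if_pos hr1, rpow_zero, min_self, one_mul]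
  have : t ^ (-(D + a) / a) = (t ^ (1 / a)) ^ (-(D + a)) := by
    rw [← rpow_mul ht.le]; congr 1; ring
  rw [this]
  calc (t ^ (1 / a)) ^ (-(D + a)) = 2 ^ (D + a) * (2 * t ^ (1 / a)) ^ (-(D + a)) := by
        rw [mul_rpow (by norm_num) tp.le, ← mul_assoc, ← rpow_add (by norm_num)]; simp
    _ ≤ 2 ^ (D + 2) * (t ^ (1 / a) + r) ^ (-(D + a)) := by
        refine mul_le_mul (rpow_le_rpow_of_exponent_le (by norm_num) (by linarith))
          (rpow_le_rpow_of_nonpos (by positivity) (by linarith) (by linarith))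
          (by positivity) (by positivity)

theorem tail_le_const_mul_tail {D α₁ κ β p q σ r : ℝ} (hβ : 0 < β) (hκ : 0 ≤ κ) (hr : 0 < r)
    (h : |p - q| ≤ κ * r ^ β) : tail D α₁ p σ r ≤ exp (κ / β) * tail D α₁ q σ r := by
  rw [tail, tail]
  split_ifs with hr1
  · apply rpow_le_const_mul_rpow hr hr1 hβ hκ
    rw [abs_sub_comm] at h
    convert h using 2; ring
  · exact le_mul_of_one_le_left (by positivity) (one_le_exp (by positivity))

theorem tail_le_of_half_le {D α₁ a σ r w : ℝ} (hD : 0 ≤ D) (h1 : 0 < α₁) (h1a : α₁ ≤ a)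
    (ha2 : a ≤ 2) (hσ : 0 ≤ σ) (hσa : σ ≤ a) (hr : 0 < r) (hw : r / 2 ≤ w) :
    tail D α₁ a σ w ≤ 4 ^ (D + 2) * tail D α₁ a σ r := by
  have hw0 : 0 < w := by linarith
  have h24 : (2 : ℝ) ^ (D + 2) ≤ 4 ^ (D + 2) :=
    rpow_le_rpow (by norm_num) (by norm_num) (by positivity)
  have key : ∀ k, 0 ≤ k → k ≤ D + 2 → w ^ (-k) ≤ 2 ^ (D + 2) * r ^ (-k) := by
    intro k hk hk2
    calc w ^ (-k) ≤ (r * 2⁻¹) ^ (-k) :=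
          rpow_le_rpow_of_nonpos (by positivity) (by linarith) (by linarith)
      _ = 2 ^ k * r ^ (-k) := by
          rw [mul_rpow hr.le (by norm_num), inv_rpow (by norm_num), ← rpow_neg (by norm_num),
            neg_neg, mul_comm]
      _ ≤ _ := by gcongr; norm_num
  rw [tail, tail]
  split_ifs with hw1 hr1 hr1
  · exact (key _ (by linarith) (by linarith)).trans (by gcongr)
  · have hr1 := not_le.1 hr1
    calc w ^ (-(D + a - σ)) ≤ 2 ^ (D + 2) * r ^ (-(D + a - σ)) :=
          key _ (by linarith) (by linarith)
      _ ≤ 2 ^ (D + 2) * 1 := by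
          gcongr; exact rpow_le_one_of_one_le_of_nonpos hr1.le (by linarith)
      _ ≤ 2 ^ (D + 2) * (2 ^ (D + 2) * r ^ (-(D + α₁))) := by
          gcongr
          rw [rpow_neg hr.le, ← div_eq_mul_inv, one_le_div (by positivity)]
          calc r ^ (D + α₁) ≤ 2 ^ (D + α₁) := rpow_le_rpow hr.le (by linarith) (by linarith)
            _ ≤ _ := rpow_le_rpow_of_exponent_le (by norm_num) (by linarith)
      _ = _ := by
          rw [← mul_assoc, ← mul_rpow (by norm_num) (by norm_num)]; norm_num
  · calc w ^ (-(D + α₁)) ≤ 1 :=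
          rpow_le_one_of_one_le_of_nonpos (not_le.1 hw1).le (by linarith)
      _ ≤ r ^ (-(D + a - σ)) :=
          one_le_rpow_of_pos_of_le_one_of_nonpos hr hr1 (by linarith)
      _ ≤ _ := le_mul_of_one_le_left (by positivity)
          (one_le_rpow (by norm_num) (by positivity))
  · exact (key _ (by linarith) (by linarith)).trans (by gcongr)

theorem lintegral_add_norm_rpow {d : ℕ} {R k : ℝ} (hR : 0 < R) :
    ∫⁻ z : EuclideanSpace ℝ (Fin d), ENNReal.ofReal ((R + ‖z‖) ^ (-k)) =
      ENNReal.ofReal (R ^ ((d : ℝ) - k)) *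
        ∫⁻ z : EuclideanSpace ℝ (Fin d), ENNReal.ofReal ((1 + ‖z‖) ^ (-k)) := by
  have hmap := Measure.map_addHaar_smul
    (volume : Measure (EuclideanSpace ℝ (Fin d))) hR.ne'
  have hf : Measurable fun z : EuclideanSpace ℝ (Fin d) => ENNReal.ofReal ((R + ‖z‖) ^ (-k)) := by
    fun_prop
  have hg := lintegral_map (μ := volume) hf (measurable_const_smul R)
  rw [hmap, lintegral_smul_measure, finrank_euclideanSpace_fin, abs_of_pos (by positivity)] at hg
  have hpt : ∀ w : EuclideanSpace ℝ (Fin d), ENNReal.ofReal ((R + ‖R • w‖) ^ (-k)) =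
      ENNReal.ofReal (R ^ (-k)) * ENNReal.ofReal ((1 + ‖w‖) ^ (-k)) := by
    intro w
    rw [← ENNReal.ofReal_mul (by positivity), ← mul_rpow hR.le (by positivity), norm_smul,
      Real.norm_of_nonneg hR.le]
    congr 2; ring
  simp_rw [hpt] at hg
  rw [lintegral_const_mul' _ _ ENNReal.ofReal_ne_top, smul_eq_mul] at hg
  have hd : R ^ ((d : ℝ) - k) = R ^ d * R ^ (-k) := by
    rw [sub_eq_add_neg, rpow_add hR, rpow_natCast]
  rw [hd, ENNReal.ofReal_mul (by positivity), mul_assoc, ← hg, ← mul_assoc,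
    ← ENNReal.ofReal_mul (by positivity), mul_inv_cancel₀ (by positivity), ENNReal.ofReal_one,
    one_mul]

theorem exists_lintegral_one_add_norm_le {d : ℕ} {δ : ℝ} (hδ : 0 < δ) : ∃ C > 0,
    ∫⁻ z : EuclideanSpace ℝ (Fin d), ENNReal.ofReal ((1 + ‖z‖) ^ (-((d : ℝ) + δ))) ≤
      ENNReal.ofReal C := by
  have h := finite_integral_one_add_norm
    (μ := (volume : Measure (EuclideanSpace ℝ (Fin d)))) (r := (d : ℝ) + δ)
    (by rw [finrank_euclideanSpace_fin]; linarith)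
  refine ⟨(∫⁻ z : EuclideanSpace ℝ (Fin d),
    ENNReal.ofReal ((1 + ‖z‖) ^ (-((d : ℝ) + δ)))).toReal + 1, by positivity, ?_⟩
  refine (ENNReal.ofReal_toReal h.ne).symm.le.trans (ENNReal.ofReal_le_ofReal (by linarith))

/-- The spatial integral of the kernel gains the parabolic power of time. -/
theorem exists_lintegral_ker_le (d : ℕ) {α₁ σ δ : ℝ} (h1 : 0 < α₁) (hσ : 0 ≤ σ) (hδ : 0 < δ) :
    ∃ C > 0, ∀ b s : ℝ, α₁ ≤ b → b ≤ 2 → σ + δ ≤ b → 0 < s → s ≤ 1 →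
      ∀ y : EuclideanSpace ℝ (Fin d),
      ∫⁻ z, ENNReal.ofReal (ker d α₁ b σ s ‖z - y‖) ≤ ENNReal.ofReal (C * s ^ (σ / b - 1)) := by
  obtain ⟨A, hA, hA'⟩ := exists_lintegral_one_add_norm_le (d := d) hδ
  obtain ⟨B, hB, hB'⟩ := exists_lintegral_one_add_norm_le (d := d) h1
  refine ⟨A + 2 ^ ((d : ℝ) + α₁) * B, by positivity, ?_⟩
  intro b s hb hb2 hσb hs hs1 y
  have hb0 : 0 < b := h1.trans_le hb
  have tp : 0 < s ^ (1 / b) := by positivity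
  rw [lintegral_sub_right_eq_self (μ := (volume : Measure (EuclideanSpace ℝ (Fin d))))
    (fun z => ENNReal.ofReal (ker d α₁ b σ s ‖z‖)) y]
  have hpt : ∀ z : EuclideanSpace ℝ (Fin d), ENNReal.ofReal (ker d α₁ b σ s ‖z‖) ≤
      ENNReal.ofReal ((s ^ (1 / b) + ‖z‖) ^ (-((d : ℝ) + b - σ))) +
      ENNReal.ofReal (2 ^ ((d : ℝ) + α₁)) *
        ENNReal.ofReal ((1 + ‖z‖) ^ (-((d : ℝ) + α₁))) := by
    intro z
    rw [← ENNReal.ofReal_mul (by positivity), ← ENNReal.ofReal_add (by positivity) (by positivity)]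
    apply ENNReal.ofReal_le_ofReal
    rcases le_or_gt ‖z‖ 1 with hz | hz
    · refine (ker_le_add_rpow hσ (norm_nonneg z) hz hs).trans ?_
      exact le_add_of_nonneg_right (by positivity)
    · refine (ker_le_rpow_of_one_lt hz).trans ?_
      refine le_trans ?_ (le_add_of_nonneg_left (by positivity))
      have hz0 : 0 < ‖z‖ := by linarith
      calc ‖z‖ ^ (-((d : ℝ) + α₁))
          = 2 ^ ((d : ℝ) + α₁) * (2 * ‖z‖) ^ (-((d : ℝ) + α₁)) := by
            rw [mul_rpow (by norm_num) hz0.le, ← mul_assoc, ← rpow_add (by norm_num)]; simp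
        _ ≤ _ := by
            refine mul_le_mul_of_nonneg_left ?_ (by positivity)
            exact rpow_le_rpow_of_nonpos (by positivity) (by linarith)
              (by have : (0 : ℝ) ≤ d := by positivity
                  linarith)
  refine (lintegral_mono hpt).trans ?_
  rw [lintegral_add_left (by fun_prop), lintegral_const_mul' _ _ ENNReal.ofReal_ne_top,
    lintegral_add_norm_rpow tp]
  have hexp : (s ^ (1 / b)) ^ ((d : ℝ) - ((d : ℝ) + b - σ)) = s ^ (σ / b - 1) := by
    rw [← rpow_mul hs.le]; congr 1; field_simp; ring
  have hone : 1 ≤ s ^ (σ / b - 1) := by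
    apply one_le_rpow_of_pos_of_le_one_of_nonpos hs hs1
    rw [sub_nonpos, div_le_one hb0]; linarith
  have hfirst : ∫⁻ z : EuclideanSpace ℝ (Fin d),
      ENNReal.ofReal ((1 + ‖z‖) ^ (-((d : ℝ) + b - σ))) ≤ ENNReal.ofReal A := by
    refine (lintegral_mono fun z => ENNReal.ofReal_le_ofReal ?_).trans hA'
    exact rpow_le_rpow_of_exponent_le (by linarith [norm_nonneg z]) (by linarith)
  rw [hexp]
  calc _ ≤ ENNReal.ofReal (s ^ (σ / b - 1)) * ENNReal.ofReal A +
        ENNReal.ofReal (2 ^ ((d : ℝ) + α₁)) * ENNReal.ofReal B := by gcongr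
    _ = ENNReal.ofReal (s ^ (σ / b - 1) * A + 2 ^ ((d : ℝ) + α₁) * B) := by
      rw [← ENNReal.ofReal_mul (by positivity), ← ENNReal.ofReal_mul (by positivity),
        ← ENNReal.ofReal_add (by positivity) (by positivity)]
    _ ≤ _ := by
      apply ENNReal.ofReal_le_ofReal
      have : 2 ^ ((d : ℝ) + α₁) * B ≤ 2 ^ ((d : ℝ) + α₁) * B * s ^ (σ / b - 1) :=
        le_mul_of_one_le_right (by positivity) hone
      linarith

theorem rpow_le_two_rpow_mul {t τ e M : ℝ} (hτ : t / 2 ≤ τ) (hτt : τ ≤ t) (ht : 0 < t)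
    (he : |e| ≤ M) : τ ^ e ≤ 2 ^ M * t ^ e := by
  have hk : 2⁻¹ ≤ τ / t := by rw [le_div_iff₀ ht]; linarith
  have hk1 : τ / t ≤ 1 := (div_le_one ht).2 hτt
  have h0 : 0 < τ / t := by linarith
  have hM : 0 ≤ M := (abs_nonneg e).trans he
  calc τ ^ e = (τ / t) ^ e * t ^ e := by
        rw [← mul_rpow h0.le ht.le, div_mul_cancel₀ _ ht.ne']
    _ ≤ 2 ^ M * t ^ e := by
        gcongr
        calc (τ / t) ^ e ≤ (τ / t) ^ (-M) :=
              rpow_le_rpow_of_exponent_ge h0 hk1 (neg_le_of_abs_le he)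
          _ ≤ (2⁻¹) ^ (-M) := rpow_le_rpow_of_nonpos (by norm_num) hk (by linarith)
          _ = 2 ^ M := by rw [inv_rpow (by norm_num), ← rpow_neg (by norm_num), neg_neg]

theorem lintegral_Ioo_rpow {t v : ℝ} (ht : 0 < t) (hv : 0 < v) :
    ∫⁻ s in Ioo 0 t, ENNReal.ofReal (s ^ (v - 1)) = ENNReal.ofReal (t ^ v / v) := by
  have hint : IntervalIntegrable (fun s : ℝ => s ^ (v - 1)) volume 0 t :=
    intervalIntegral.intervalIntegrable_rpow' (by linarith)
  rw [restrict_Ioo_eq_restrict_Ioc, ← ofReal_integral_eq_lintegral_ofReal hint.1,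
    ← intervalIntegral.integral_of_le ht.le, integral_rpow (Or.inl (by linarith))]
  · congr 1
    rw [sub_add_cancel, zero_rpow hv.ne', sub_zero]
  · filter_upwards [ae_restrict_mem measurableSet_Ioc] with s hs
    exact rpow_nonneg hs.1.le _

theorem lintegral_Ioo_sub_rpow {t v : ℝ} (ht : 0 < t) (hv : 0 < v) :
    ∫⁻ s in Ioo 0 t, ENNReal.ofReal ((t - s) ^ (v - 1)) = ENNReal.ofReal (t ^ v / v) := by
  rw [← lintegral_Ioo_rpow ht hv, ← lintegral_indicator measurableSet_Ioo,
    ← lintegral_indicator measurableSet_Ioo,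
    ← lintegral_sub_left_eq_self _ t]
  congr 1
  ext s
  simp only [indicator, mem_Ioo]
  congr 1
  · rw [sub_pos, sub_lt_self_iff, and_comm]
  · rw [sub_sub_cancel]

theorem lintegral_Ioo_le_of_le_add {t u v A B : ℝ} {f : ℝ → ENNReal} (ht : 0 < t) (hu : 0 < u)
    (hv : 0 < v) (hA : 0 ≤ A) (hB : 0 ≤ B)
    (hf : ∀ s ∈ Ioo 0 t, f s ≤ ENNReal.ofReal (A * s ^ (v - 1) + B * (t - s) ^ (u - 1))) :
    ∫⁻ s in Ioo 0 t, f s ≤ ENNReal.ofReal (A * (t ^ v / v) + B * (t ^ u / u)) := by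
  refine (setLIntegral_mono' (g := fun s => ENNReal.ofReal A * ENNReal.ofReal (s ^ (v - 1)) +
    ENNReal.ofReal B * ENNReal.ofReal ((t - s) ^ (u - 1))) measurableSet_Ioo ?_).trans ?_
  · intro s hs
    refine (hf s hs).trans ?_
    rw [← ENNReal.ofReal_mul hA, ← ENNReal.ofReal_mul hB]
    exact ENNReal.ofReal_add_le
  · rw [lintegral_add_left (by fun_prop), lintegral_const_mul' _ _ ENNReal.ofReal_ne_top,
      lintegral_const_mul' _ _ ENNReal.ofReal_ne_top, lintegral_Ioo_rpow ht hv,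
      lintegral_Ioo_sub_rpow ht hu, ← ENNReal.ofReal_mul hA, ← ENNReal.ofReal_mul hB,
      ← ENNReal.ofReal_add (by positivity) (by positivity)]

theorem rpow_sub_mul_rpow_le {t s u v M : ℝ} (hs : s ∈ Ioo 0 t) (hu : |u - 1| ≤ M)
    (hv : |v - 1| ≤ M) : (t - s) ^ (u - 1) * s ^ (v - 1) ≤
      2 ^ M * (t ^ (u - 1) * s ^ (v - 1) + t ^ (v - 1) * (t - s) ^ (u - 1)) := by
  obtain ⟨hs0, hst⟩ := hs
  have ht : 0 < t := hs0.trans hst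
  have hτ : 0 < t - s := sub_pos.2 hst
  rcases le_total s (t / 2) with h | h
  · have := rpow_le_two_rpow_mul (by linarith : t / 2 ≤ t - s) (by linarith) ht hu
    calc _ ≤ 2 ^ M * t ^ (u - 1) * s ^ (v - 1) := by gcongr
      _ ≤ 2 ^ M * t ^ (u - 1) * s ^ (v - 1) + 2 ^ M * (t ^ (v - 1) * (t - s) ^ (u - 1)) :=
        le_add_of_nonneg_right (by positivity)
      _ = _ := by ring
  · have := rpow_le_two_rpow_mul h hst.le ht hv
    calc _ ≤ (t - s) ^ (u - 1) * (2 ^ M * t ^ (v - 1)) := by gcongr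
      _ ≤ (t - s) ^ (u - 1) * (2 ^ M * t ^ (v - 1)) + 2 ^ M * (t ^ (u - 1) * s ^ (v - 1)) :=
        le_add_of_nonneg_right (by positivity)
      _ = _ := by ring

theorem lintegral_Ioo_sub_rpow_mul_rpow_le {t u v M : ℝ} (ht : 0 < t) (hu : 0 < u) (hv : 0 < v)
    (huM : |u - 1| ≤ M) (hvM : |v - 1| ≤ M) :
    ∫⁻ s in Ioo 0 t, ENNReal.ofReal ((t - s) ^ (u - 1) * s ^ (v - 1)) ≤
      ENNReal.ofReal (2 ^ M * (1 / u + 1 / v) * t ^ (u + v - 1)) := by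
  refine (lintegral_Ioo_le_of_le_add (A := 2 ^ M * t ^ (u - 1)) (B := 2 ^ M * t ^ (v - 1)) ht hu hv
    (by positivity) (by positivity) fun s hs => ?_).trans (le_of_eq ?_)
  · refine ENNReal.ofReal_le_ofReal ((rpow_sub_mul_rpow_le hs huM hvM).trans (le_of_eq ?_))
    ring
  · have e₁ : t ^ (u + v - 1) = t ^ (u - 1) * t ^ v := by rw [← rpow_add ht]; ring_nf
    have e₂ : t ^ (u - 1) * t ^ v = t ^ (v - 1) * t ^ u := by
      rw [← rpow_add ht, ← rpow_add ht]; ring_nf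
    congr 1
    rw [e₁]
    calc _ = 2 ^ M * (t ^ (u - 1) * t ^ v) * (1 / v) +
          2 ^ M * (t ^ (v - 1) * t ^ u) * (1 / u) := by ring
      _ = _ := by rw [← e₂]; ring

/-- Bounds for the spatial convolution of two kernels at fixed times: either factor may be
estimated by its maximum, and away from the diagonal by its tail. -/
theorem exists_lintegral_rho_mul_rho_le {d : ℕ} {α₁ α₂ : ℝ} (h1 : 0 < α₁) (h2 : α₂ < 2)
    {α : EuclideanSpace ℝ (Fin d) → ℝ} (hαb : ∀ x, α x ∈ Icc α₁ α₂)
    {c₁ β₁ : ℝ} (hc₁ : 0 < c₁) (hβ₁ : 0 < β₁)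
    (hαH : ∀ x y, |α x - α y| ≤ c₁ * ‖x - y‖ ^ β₁) (θ₁ θ₂ : ℝ) {σ₁ σ₂ : ℝ}
    (hσ₁ : 0 < σ₁) (hσ₂ : 0 < σ₂) :
    ∃ C > 0, ∀ x y : EuclideanSpace ℝ (Fin d), σ₁ + σ₂ ≤ α x → σ₁ + σ₂ ≤ α y →
      ∀ τ s : ℝ, 0 < τ → τ ≤ 1 → 0 < s → s ≤ 1 →
      (∫⁻ z, ENNReal.ofReal (rho d α α₁ θ₁ z σ₁ τ (x - z) * rho d α α₁ θ₂ y σ₂ s (z - y)) ≤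
        ENNReal.ofReal (C * (τ ^ (θ₁ + (σ₁ - d - α x) / α x) * s ^ (θ₂ + σ₂ / α y - 1)))) ∧
      (∫⁻ z, ENNReal.ofReal (rho d α α₁ θ₁ z σ₁ τ (x - z) * rho d α α₁ θ₂ y σ₂ s (z - y)) ≤
        ENNReal.ofReal (C * (s ^ (θ₂ + (σ₂ - d - α y) / α y) * τ ^ (θ₁ + σ₁ / α x - 1)))) ∧
      (x ≠ y →
        ∫⁻ z, ENNReal.ofReal (rho d α α₁ θ₁ z σ₁ τ (x - z) * rho d α α₁ θ₂ y σ₂ s (z - y)) ≤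
        ENNReal.ofReal (C * (tail d α₁ (α x) σ₁ ‖x - y‖ *
            (τ ^ θ₁ * s ^ (θ₂ + σ₂ / α y - 1)) +
          tail d α₁ (α y) σ₂ ‖x - y‖ * (τ ^ (θ₁ + σ₁ / α x - 1) * s ^ θ₂)))) := by
  have hd : (0 : ℝ) ≤ d := by positivity
  obtain ⟨C₀, hC₀, hcomp⟩ := exists_ker_le_const_mul (D := d) hd h1 hβ₁ hc₁.le
  obtain ⟨C₁, hC₁, hint₁⟩ := exists_lintegral_ker_le d h1 hσ₁.le hσ₂
  obtain ⟨C₂, hC₂, hint₂⟩ := exists_lintegral_ker_le d h1 hσ₂.le hσ₁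
  set W : ℝ := 4 ^ ((d : ℝ) + 2) with hW
  have hW1 : 1 ≤ W := one_le_rpow (by norm_num) (by positivity)
  set C := C₀ * W * (C₁ + C₂) with hC
  refine ⟨C, by positivity, ?_⟩
  intro x y hx hy τ s hτ hτ1 hs hs1
  obtain ⟨hx1, hx2⟩ := hαb x
  obtain ⟨hy1, hy2⟩ := hαb y
  set a := α x
  set b := α y
  have ha0 : 0 < a := h1.trans_le hx1
  have hb0 : 0 < b := h1.trans_le hy1
  have hCC₁ : C₀ * W * C₁ ≤ C := by rw [hC]; gcongr; linarith
  have hCC₂ : C₀ * W * C₂ ≤ C := by rw [hC]; gcongr; linarith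
  have hC₁' : C₀ * C₁ ≤ C := le_trans (by gcongr; exact le_mul_of_one_le_right hC₀.le hW1) hCC₁
  have hC₂' : C₀ * C₂ ≤ C := le_trans (by gcongr; exact le_mul_of_one_le_right hC₀.le hW1) hCC₂
  set T := τ ^ θ₁ * s ^ θ₂ with hT
  have hT0 : 0 < T := by positivity
  have eτ : ∀ e, τ ^ (θ₁ + e) = τ ^ θ₁ * τ ^ e := fun e => rpow_add hτ _ _
  have es : ∀ e, s ^ (θ₂ + e) = s ^ θ₂ * s ^ e := fun e => rpow_add hs _ _
  have hk₁ : ∀ z, 0 ≤ ker d α₁ a σ₁ τ ‖z - x‖ := fun z => ker_nonneg hτ.le (norm_nonneg _)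
  have hk₂ : ∀ z, 0 ≤ ker d α₁ b σ₂ s ‖z - y‖ := fun z => ker_nonneg hs.le (norm_nonneg _)
  have hbound : ∀ z, rho d α α₁ θ₁ z σ₁ τ (x - z) * rho d α α₁ θ₂ y σ₂ s (z - y) ≤
      C₀ * T * (ker d α₁ a σ₁ τ ‖z - x‖ * ker d α₁ b σ₂ s ‖z - y‖) := by
    intro z
    rw [rho_eq_ker, rho_eq_ker, norm_sub_rev x z]
    have := hcomp (α z) a σ₁ ‖z - x‖ τ (hαb z).1 hx1 (by linarith) (norm_nonneg _) hτ hτ1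
      (hαH z x)
    calc _ ≤ τ ^ θ₁ * (C₀ * ker d α₁ a σ₁ τ ‖z - x‖) *
          (s ^ θ₂ * ker d α₁ b σ₂ s ‖z - y‖) := by
          have := hk₂ z
          gcongr
      _ = _ := by rw [hT]; ring
  have hmain : ∀ P Q : ℝ, 0 ≤ P → 0 ≤ Q →
      (∀ z, ker d α₁ a σ₁ τ ‖z - x‖ * ker d α₁ b σ₂ s ‖z - y‖ ≤
        P * ker d α₁ b σ₂ s ‖z - y‖ + Q * ker d α₁ a σ₁ τ ‖z - x‖) →
      ∫⁻ z, ENNReal.ofReal (rho d α α₁ θ₁ z σ₁ τ (x - z) * rho d α α₁ θ₂ y σ₂ s (z - y)) ≤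
        ENNReal.ofReal (C₀ * T * (P * (C₂ * s ^ (σ₂ / b - 1)) + Q * (C₁ * τ ^ (σ₁ / a - 1)))) := by
    intro P Q hP hQ hPQ
    have hmeas : Measurable fun z : EuclideanSpace ℝ (Fin d) =>
        ENNReal.ofReal (ker d α₁ b σ₂ s ‖z - y‖) := by
      unfold ker
      refine ENNReal.measurable_ofReal.comp (Measurable.mul (by fun_prop) ?_)
      exact Measurable.ite (measurableSet_le (by fun_prop) (by fun_prop)) (by fun_prop)
        (by fun_prop)
    have hpt : ∀ z, ENNReal.ofReal
        (rho d α α₁ θ₁ z σ₁ τ (x - z) * rho d α α₁ θ₂ y σ₂ s (z - y)) ≤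
        ENNReal.ofReal (C₀ * T * P) * ENNReal.ofReal (ker d α₁ b σ₂ s ‖z - y‖) +
        ENNReal.ofReal (C₀ * T * Q) * ENNReal.ofReal (ker d α₁ a σ₁ τ ‖z - x‖) := by
      intro z
      rw [← ENNReal.ofReal_mul (by positivity), ← ENNReal.ofReal_mul (by positivity)]
      refine le_trans (ENNReal.ofReal_le_ofReal ?_) ENNReal.ofReal_add_le
      refine (hbound z).trans ((mul_le_mul_of_nonneg_left (hPQ z) (by positivity)).trans
        (le_of_eq ?_))
      ring
    refine (lintegral_mono hpt).trans ?_
    rw [lintegral_add_left (hmeas.const_mul _), lintegral_const_mul' _ _ ENNReal.ofReal_ne_top,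
      lintegral_const_mul' _ _ ENNReal.ofReal_ne_top]
    have i₁ := hint₁ a τ hx1 (by linarith) hx hτ hτ1 x
    have i₂ := hint₂ b s hy1 (by linarith) (by linarith) hs hs1 y
    calc _ ≤ ENNReal.ofReal (C₀ * T * P) * ENNReal.ofReal (C₂ * s ^ (σ₂ / b - 1)) +
          ENNReal.ofReal (C₀ * T * Q) * ENNReal.ofReal (C₁ * τ ^ (σ₁ / a - 1)) := by gcongr
      _ = _ := by
        rw [← ENNReal.ofReal_mul (by positivity), ← ENNReal.ofReal_mul (by positivity),
          ← ENNReal.ofReal_add (by positivity) (by positivity)]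
        congr 1; ring
  refine ⟨?_, ?_, ?_⟩
  · refine (hmain (τ ^ ((σ₁ - d - a) / a)) 0 (by positivity) le_rfl fun z => ?_).trans ?_
    · rw [zero_mul, add_zero]
      exact mul_le_mul_of_nonneg_right (ker_le_time h1 ha0 hd hσ₁.le (by linarith)
        (norm_nonneg _) hτ hτ1) (hk₂ z)
    · apply ENNReal.ofReal_le_ofReal
      rw [eτ, add_sub_assoc, es]
      calc _ = C₀ * C₂ * (τ ^ θ₁ * τ ^ ((σ₁ - d - a) / a) *
            (s ^ θ₂ * s ^ (σ₂ / b - 1))) := by rw [hT]; ring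
        _ ≤ _ := by gcongr
  · refine (hmain 0 (s ^ ((σ₂ - d - b) / b)) le_rfl (by positivity) fun z => ?_).trans ?_
    · rw [zero_mul, zero_add, mul_comm]
      exact mul_le_mul_of_nonneg_right (ker_le_time h1 hb0 hd hσ₂.le (by linarith)
        (norm_nonneg _) hs hs1) (hk₁ z)
    · apply ENNReal.ofReal_le_ofReal
      rw [es, add_sub_assoc, eτ]
      calc _ = C₀ * C₁ * (s ^ θ₂ * s ^ ((σ₂ - d - b) / b) *
            (τ ^ θ₁ * τ ^ (σ₁ / a - 1))) := by rw [hT]; ring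
        _ ≤ _ := by gcongr
  · intro hxy
    have hr : 0 < ‖x - y‖ := norm_pos_iff.2 (sub_ne_zero.2 hxy)
    have ht₁ : 0 ≤ tail d α₁ a σ₁ ‖x - y‖ := tail_nonneg hr.le
    have ht₂ : 0 ≤ tail d α₁ b σ₂ ‖x - y‖ := tail_nonneg hr.le
    refine (hmain (W * tail d α₁ a σ₁ ‖x - y‖) (W * tail d α₁ b σ₂ ‖x - y‖)
      (by positivity) (by positivity) fun z => ?_).trans ?_
    · have htri : ‖x - y‖ ≤ ‖z - x‖ + ‖z - y‖ := by
        rw [norm_sub_rev z x]; exact norm_sub_le_norm_sub_add_norm_sub x z y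
      rcases le_total (‖x - y‖ / 2) ‖z - x‖ with h | h
      · refine le_trans (mul_le_mul_of_nonneg_right ?_ (hk₂ z))
          (le_add_of_nonneg_right (mul_nonneg (by positivity) (hk₁ z)))
        exact (ker_le_tail hd hσ₁.le (by linarith) (by linarith) hτ).trans
          (tail_le_of_half_le hd h1 hx1 (by linarith) hσ₁.le (by linarith) hr h)
      · refine le_trans ?_ (le_add_of_nonneg_left (mul_nonneg (by positivity) (hk₂ z)))
        rw [mul_comm]
        refine mul_le_mul_of_nonneg_right ?_ (hk₁ z)
        have h' : ‖x - y‖ / 2 ≤ ‖z - y‖ := by linarith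
        exact (ker_le_tail hd hσ₂.le (by linarith) (by linarith) hs).trans
          (tail_le_of_half_le hd h1 hy1 (by linarith) hσ₂.le (by linarith) hr h')
    · apply ENNReal.ofReal_le_ofReal
      rw [add_sub_assoc, es, add_sub_assoc, eτ, mul_add C]
      calc _ = C₀ * W * C₂ * (tail d α₁ a σ₁ ‖x - y‖ *
              (τ ^ θ₁ * (s ^ θ₂ * s ^ (σ₂ / b - 1)))) +
            C₀ * W * C₁ * (tail d α₁ b σ₂ ‖x - y‖ *
              (τ ^ θ₁ * τ ^ (σ₁ / a - 1) * s ^ θ₂)) := by rw [hT]; ring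
        _ ≤ _ := by gcongr

theorem betaFn_pos {a b : ℝ} (ha : 0 < a) (hb : 0 < b) : 0 < betaFn a b := by
  unfold betaFn
  have := Real.Gamma_pos_of_pos ha
  have := Real.Gamma_pos_of_pos hb
  have := Real.Gamma_pos_of_pos (add_pos ha hb)
  positivity

set_option maxHeartbeats 1000000 in
theorem stmt12
    (d : ℕ) (hd : 1 ≤ d)
    (α₁ α₂ : ℝ) (h1 : 0 < α₁) (h12 : α₁ ≤ α₂) (h2 : α₂ < 2)
    (α : EuclideanSpace ℝ (Fin d) → ℝ) (hαm : Measurable α)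
    (hαb : ∀ x, α x ∈ Icc α₁ α₂)
    (c₁ β₁ : ℝ) (hc₁ : 0 < c₁) (hβ₁ : β₁ ∈ Ioc (0:ℝ) 1)
    (hαH : ∀ x y, |α x - α y| ≤ c₁ * min (‖x - y‖ ^ β₁) 1)
    (θ₁ θ₂ : ℝ) (σ₁ σ₂ : ℝ) (hσ₁ : σ₁ ∈ Ioo (0:ℝ) 1) (hσ₂ : σ₂ ∈ Ioo (0:ℝ) 1)
    (hθ₁ : 0 < θ₁ + σ₁ / α₂) (hθ₂ : 0 < θ₂ + σ₂ / α₂) :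
    ∃ c > 0, ∀ t ∈ Ioc (0:ℝ) 1, ∀ x y : EuclideanSpace ℝ (Fin d),
      σ₁ + σ₂ < min (α x) (α y) →
      0 < θ₁ + σ₁ / α x →
      0 < θ₂ + σ₂ / α y →
      (∫⁻ s in Ioo (0:ℝ) t, ∫⁻ z, ENNReal.ofReal
          (rho d α α₁ θ₁ z σ₁ (t - s) (x - z) * rho d α α₁ θ₂ y σ₂ s (z - y)))
        ≤ ENNReal.ofReal (c * betaFn (σ₁ / α₂ + θ₁) (σ₂ / α₂ + θ₂) *
            (rho d α α₁ (θ₁ + θ₂ + (σ₁ + σ₂) / max (α x) (α y)) y 0 t (x - y)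
            + rho d α α₁ (θ₁ + θ₂ + σ₁ / α x) y σ₂ t (x - y)
            + rho d α α₁ (θ₁ + θ₂ + σ₂ / α y) y σ₁ t (x - y))) := by
  have hb₁ := betaFn_pos (a := σ₁ / α₂ + θ₁) (b := σ₂ / α₂ + θ₂) (by linarith) (by linarith)
  have hσ₁0 := hσ₁.1
  have hσ₂0 := hσ₂.1
  have hα₂ : 0 < α₂ := h1.trans_le h12
  have hd0 : (0 : ℝ) ≤ d := by positivity
  have hαH' : ∀ x y, |α x - α y| ≤ c₁ * ‖x - y‖ ^ β₁ := fun x y =>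
    (hαH x y).trans (mul_le_mul_of_nonneg_left (min_le_left _ _) hc₁.le)
  obtain ⟨C, hC, hconv⟩ := exists_lintegral_rho_mul_rho_le h1 h2 hαb hc₁ hβ₁.1 hαH' θ₁ θ₂
    hσ₁0 hσ₂0
  set u₀ := θ₁ + σ₁ / α₂
  set v₀ := θ₂ + σ₂ / α₂
  set M := |θ₁| + |θ₂| + d / α₁ + 1 with hM
  set N := 1 / u₀ + 1 / v₀ with hN
  set A₀ := exp (c₁ / β₁) with hA₀
  set B₀ := exp (d * c₁ / α₁ ^ 2 / (β₁ / 2)) with hB₀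
  have hA1 : 1 ≤ A₀ := one_le_exp (by have := hβ₁.1; positivity)
  have hB1 : 1 ≤ B₀ := one_le_exp (by have := hβ₁.1; positivity)
  set V : ℝ := 2 ^ ((d : ℝ) + 2) with hV
  set K := C * 2 ^ M * N * (A₀ * B₀) * V with hK
  refine ⟨K / betaFn (σ₁ / α₂ + θ₁) (σ₂ / α₂ + θ₂), by positivity, ?_⟩
  rintro t ⟨ht, ht1⟩ x y hσ - -
  rw [div_mul_cancel₀ _ hb₁.ne']
  obtain ⟨hσx, hσy⟩ := lt_min_iff.1 hσ
  obtain ⟨hx1, hx2⟩ := hαb x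
  obtain ⟨hy1, hy2⟩ := hαb y
  have hconv := hconv x y hσx.le hσy.le
  have hαxy := hαH' x y
  simp only [rho_eq_ker d α α₁ _ y _ t]
  set a := α x
  set b := α y
  set r := ‖x - y‖
  have ha0 : 0 < a := h1.trans_le hx1
  have hb0 : 0 < b := h1.trans_le hy1
  set u := θ₁ + σ₁ / a with hu
  set v := θ₂ + σ₂ / b with hv
  have hu₀ : u₀ ≤ u := by simp only [u₀, u]; gcongr
  have hv₀ : v₀ ≤ v := by simp only [v₀, v]; gcongr
  have hu0 : 0 < u := hθ₁.trans_le hu₀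
  have hv0 : 0 < v := hθ₂.trans_le hv₀
  have hσa : σ₁ / a ≤ 1 := (div_le_one ha0).2 (by linarith)
  have hσb : σ₂ / b ≤ 1 := (div_le_one hb0).2 (by linarith)
  have hσa0 : 0 < σ₁ / a := by positivity
  have hσb0 : 0 < σ₂ / b := by positivity
  have hda : (d : ℝ) / a ≤ d / α₁ := by gcongr
  have hdb : (d : ℝ) / b ≤ d / α₁ := by gcongr
  have hda0 : 0 ≤ (d : ℝ) / a := by positivity
  have hdb0 : 0 ≤ (d : ℝ) / b := by positivity
  have hθ₁a := abs_le.1 (le_refl |θ₁|)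
  have hθ₂a := abs_le.1 (le_refl |θ₂|)
  have hθ₁n := abs_nonneg θ₁
  have hθ₂n := abs_nonneg θ₂
  have hr : 0 ≤ r := norm_nonneg _
  have hk : ∀ σ, 0 ≤ ker d α₁ b σ t r := fun σ => ker_nonneg ht.le hr
  have hS₁ := mul_nonneg (rpow_nonneg ht.le (θ₁ + θ₂ + (σ₁ + σ₂) / max a b)) (hk 0)
  have hS₂ := mul_nonneg (rpow_nonneg ht.le (θ₁ + θ₂ + σ₁ / a)) (hk σ₂)
  have hS₃ := mul_nonneg (rpow_nonneg ht.le (θ₁ + θ₂ + σ₂ / b)) (hk σ₁)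
  have hN0 : 0 < N := by positivity
  have hV0 : 0 < V := by positivity
  rcases le_or_gt r (t ^ (1 / b)) with hnear | hfar
  · set E₁ := θ₁ + (σ₁ - d - a) / a with hE₁
    set E₂ := θ₂ + (σ₂ - d - b) / b with hE₂
    have eE₁ : E₁ = θ₁ + σ₁ / a - d / a - 1 := by rw [hE₁]; field_simp; ring
    have eE₂ : E₂ = θ₂ + σ₂ / b - d / b - 1 := by rw [hE₂]; field_simp; ring
    have hE₁M : |E₁| ≤ M := by rw [eE₁, abs_le]; constructor <;> linarith
    have hE₂M : |E₂| ≤ M := by rw [eE₂, abs_le]; constructor <;> linarith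
    refine (lintegral_Ioo_le_of_le_add (A := C * 2 ^ M * t ^ E₁) (B := C * 2 ^ M * t ^ E₂)
      ht hu0 hv0 (by positivity) (by positivity) fun s hs => ?_).trans ?_
    · obtain ⟨hs0, hst⟩ := hs
      have hτ0 : 0 < t - s := sub_pos.2 hst
      obtain ⟨i₁, i₂, -⟩ := hconv (t - s) s hτ0 (by linarith) hs0 (by linarith)
      rcases le_total s (t / 2) with h | h
      · refine i₁.trans (ENNReal.ofReal_le_ofReal ?_)
        refine le_trans ?_ (le_add_of_nonneg_right (by positivity))
        have := rpow_le_two_rpow_mul (by linarith : t / 2 ≤ t - s) (by linarith) ht hE₁M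
        calc _ ≤ C * (2 ^ M * t ^ E₁ * s ^ (v - 1)) := by gcongr
          _ = _ := by ring
      · refine i₂.trans (ENNReal.ofReal_le_ofReal ?_)
        refine le_trans ?_ (le_add_of_nonneg_left (by positivity))
        have := rpow_le_two_rpow_mul h hst.le ht hE₂M
        calc _ ≤ C * (2 ^ M * t ^ E₂ * (t - s) ^ (u - 1)) := by gcongr
          _ = _ := by ring
    · apply ENNReal.ofReal_le_ofReal
      set G := θ₁ + θ₂ + (σ₁ + σ₂) / max a b with hG
      have hGle : G ≤ θ₁ + θ₂ + σ₁ / a + σ₂ / b := by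
        have g₁ : σ₁ / max a b ≤ σ₁ / a := by gcongr; exact le_max_left _ _
        have g₂ : σ₂ / max a b ≤ σ₂ / b := by gcongr; exact le_max_right _ _
        rw [hG, add_div]; linarith
      have hker := time_rpow_le_const_mul_ker (α₁ := α₁) hd0 hb0 (by linarith) ht ht1 hr hnear
      have hab : t ^ (-((d : ℝ) + a) / a) ≤ B₀ * t ^ (-((d : ℝ) + b) / b) := by
        apply time_rpow_le_const_mul hd0 h1 hx1 hy1 (by linarith) hβ₁.1 hc₁.le hr ht ht1 hnear hαxy
        have : -((d : ℝ) + a) / a - -((d : ℝ) + b) / b = d * -(1 / a - 1 / b) := by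
          field_simp; ring
        rw [this, abs_mul, abs_of_nonneg hd0, abs_neg]
      have k₁ : t ^ E₁ * t ^ v ≤ t ^ G * (B₀ * (V * ker d α₁ b 0 t r)) := by
        calc t ^ E₁ * t ^ v
            = t ^ (θ₁ + θ₂ + σ₁ / a + σ₂ / b) * t ^ (-((d : ℝ) + a) / a) := by
              rw [← rpow_add ht, ← rpow_add ht, eE₁, hv]; congr 1; field_simp; ring
          _ ≤ t ^ G * (B₀ * (V * ker d α₁ b 0 t r)) := by
              refine mul_le_mul (rpow_le_rpow_of_exponent_ge ht ht1 hGle)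
                (hab.trans (by gcongr)) (by positivity) (by positivity)
      have k₂ : t ^ E₂ * t ^ u ≤ t ^ G * (B₀ * (V * ker d α₁ b 0 t r)) := by
        have hVk := mul_nonneg hV0.le (hk 0)
        calc t ^ E₂ * t ^ u
            = t ^ (θ₁ + θ₂ + σ₁ / a + σ₂ / b) * t ^ (-((d : ℝ) + b) / b) := by
              rw [← rpow_add ht, ← rpow_add ht, eE₂, hu]; congr 1; field_simp; ring
          _ ≤ t ^ G * (B₀ * (V * ker d α₁ b 0 t r)) := by
              refine mul_le_mul (rpow_le_rpow_of_exponent_ge ht ht1 hGle)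
                (hker.trans (le_mul_of_one_le_left hVk hB1)) (by positivity) (by positivity)
      have hX : 0 ≤ t ^ G * (B₀ * (V * ker d α₁ b 0 t r)) := le_trans (by positivity) k₁
      calc C * 2 ^ M * t ^ E₁ * (t ^ v / v) + C * 2 ^ M * t ^ E₂ * (t ^ u / u)
          = C * 2 ^ M * (t ^ E₁ * t ^ v * (1 / v) + t ^ E₂ * t ^ u * (1 / u)) := by ring
        _ ≤ C * 2 ^ M * (t ^ G * (B₀ * (V * ker d α₁ b 0 t r)) * (1 / v₀) +
            t ^ G * (B₀ * (V * ker d α₁ b 0 t r)) * (1 / u₀)) := by gcongr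
        _ = C * 2 ^ M * N * B₀ * V * (t ^ G * ker d α₁ b 0 t r) := by rw [hN]; ring
        _ ≤ K * (t ^ G * ker d α₁ b 0 t r) := by
            rw [hK]
            gcongr
            exact le_mul_of_one_le_left (by positivity) hA1
        _ ≤ _ := by gcongr; linarith
  · have hr0 : 0 < r := lt_trans (by positivity) hfar
    have hxy : x ≠ y := sub_ne_zero.1 (norm_pos_iff.1 hr0)
    have ht₁ : 0 ≤ tail d α₁ a σ₁ r := tail_nonneg hr
    have ht₂ : 0 ≤ tail d α₁ b σ₂ r := tail_nonneg hr
    have hone₁ : σ₁ / α₂ ≤ 1 := (div_le_one hα₂).2 (by linarith)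
    have hone₂ : σ₂ / α₂ ≤ 1 := (div_le_one hα₂).2 (by linarith)
    have hu₁ : u₀ ≤ θ₁ + 1 := by simp only [u₀]; linarith
    have hv₁ : v₀ ≤ θ₂ + 1 := by simp only [v₀]; linarith
    have hdα : 0 ≤ (d : ℝ) / α₁ := by positivity
    have beta₁ := lintegral_Ioo_sub_rpow_mul_rpow_le (u := θ₁ + 1) (v := v) (M := M) ht
      (by linarith) hv0 (by rw [abs_le]; constructor <;> linarith)
      (by rw [abs_le]; constructor <;> linarith)
    have beta₂ := lintegral_Ioo_sub_rpow_mul_rpow_le (u := u) (v := θ₂ + 1) (M := M) ht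
      hu0 (by linarith) (by rw [abs_le]; constructor <;> linarith)
      (by rw [abs_le]; constructor <;> linarith)
    rw [add_sub_cancel_right] at beta₁ beta₂
    refine (setLIntegral_mono' (g := fun s =>
      ENNReal.ofReal (C * tail d α₁ a σ₁ r) * ENNReal.ofReal ((t - s) ^ θ₁ * s ^ (v - 1)) +
      ENNReal.ofReal (C * tail d α₁ b σ₂ r) * ENNReal.ofReal ((t - s) ^ (u - 1) * s ^ θ₂))
      measurableSet_Ioo ?_).trans ?_
    · rintro s ⟨hs0, hst⟩
      obtain ⟨-, -, i₃⟩ := hconv (t - s) s (sub_pos.2 hst) (by linarith) hs0 (by linarith)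
      refine (i₃ hxy).trans ?_
      rw [← ENNReal.ofReal_mul (by positivity), ← ENNReal.ofReal_mul (by positivity)]
      refine le_trans (ENNReal.ofReal_le_ofReal (le_of_eq ?_)) ENNReal.ofReal_add_le
      ring
    rw [lintegral_add_left (by fun_prop), lintegral_const_mul' _ _ ENNReal.ofReal_ne_top,
      lintegral_const_mul' _ _ ENNReal.ofReal_ne_top]
    have e₁ : θ₁ + 1 + v - 1 = θ₁ + θ₂ + σ₂ / b := by rw [hv]; ring
    have e₂ : u + (θ₂ + 1) - 1 = θ₁ + θ₂ + σ₁ / a := by rw [hu]; ring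
    rw [e₁] at beta₁
    rw [e₂] at beta₂
    have n₁ : 1 / (θ₁ + 1) + 1 / v ≤ N := by rw [hN]; gcongr
    have n₂ : 1 / u + 1 / (θ₂ + 1) ≤ N := by rw [hN]; gcongr
    have n₁0 : 0 ≤ 1 / (θ₁ + 1) + 1 / v := by
      have : 0 < θ₁ + 1 := by linarith
      positivity
    have n₂0 : 0 ≤ 1 / u + 1 / (θ₂ + 1) := by
      have : 0 < θ₂ + 1 := by linarith
      positivity
    have tail₂ : tail d α₁ b σ₂ r ≤ V * ker d α₁ b σ₂ t r :=
      tail_le_const_mul_ker hd0 hσ₂0.le hb0 (by linarith) ht hfar.le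
    have tail₁ : tail d α₁ a σ₁ r ≤ A₀ * (V * ker d α₁ b σ₁ t r) :=
      (tail_le_const_mul_tail hβ₁.1 hc₁.le hr0 hαxy).trans (mul_le_mul_of_nonneg_left
        (tail_le_const_mul_ker hd0 hσ₁0.le hb0 (by linarith) ht hfar.le) (by positivity))
    have hABA : A₀ ≤ A₀ * B₀ := le_mul_of_one_le_right (by positivity) hB1
    have hAB1 : 1 ≤ A₀ * B₀ := hA1.trans hABA
    refine (add_le_add (mul_le_mul_right beta₁ _) (mul_le_mul_right beta₂ _)).trans ?_
    rw [← ENNReal.ofReal_mul (by positivity), ← ENNReal.ofReal_mul (by positivity),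
      ← ENNReal.ofReal_add (by positivity) (by positivity)]
    apply ENNReal.ofReal_le_ofReal
    have m₁ : C * tail d α₁ a σ₁ r *
        (2 ^ M * (1 / (θ₁ + 1) + 1 / v) * t ^ (θ₁ + θ₂ + σ₂ / b)) ≤
        K * (t ^ (θ₁ + θ₂ + σ₂ / b) * ker d α₁ b σ₁ t r) := by
      have := hk σ₁
      calc _ ≤ C * (A₀ * B₀ * (V * ker d α₁ b σ₁ t r)) *
            (2 ^ M * N * t ^ (θ₁ + θ₂ + σ₂ / b)) := by
            gcongr
            exact tail₁.trans (by gcongr)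
        _ = _ := by rw [hK]; ring
    have m₂ : C * tail d α₁ b σ₂ r *
        (2 ^ M * (1 / u + 1 / (θ₂ + 1)) * t ^ (θ₁ + θ₂ + σ₁ / a)) ≤
        K * (t ^ (θ₁ + θ₂ + σ₁ / a) * ker d α₁ b σ₂ t r) := by
      have := hk σ₂
      calc _ ≤ C * (A₀ * B₀ * (V * ker d α₁ b σ₂ t r)) *
            (2 ^ M * N * t ^ (θ₁ + θ₂ + σ₁ / a)) := by
            gcongr
            exact tail₂.trans (le_mul_of_one_le_left (by positivity) hAB1)
        _ = _ := by rw [hK]; ring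
    have hK0 : 0 ≤ K := by positivity
    have m₃ := mul_nonneg hK0 hS₁
    rw [mul_add, mul_add]
    linarith
end

section
/- (Maximum principle) Let u : [0,1] × ℝ^d → ℝ be bounded and continuous. Assume: (i) for every (t,x) ∈ (0,1] × ℝ^d the principal value ℒu(t,x) := lim_{σ↓0} (1/2) ∫_{|z|>σ} (u(t,x+z) + u(t,x−z) − 2u(t,x)) κ(x,z) |z|^{−(d+α(x))} dz exists, the partial derivative ∂_t u(t,x) exists, and ∂_t u(t,x) = ℒu(t,x); (ii) lim_{t↓0} sup_{x ∈ ℝ^d} |u(t,x) − u(0,x)| = 0; (iii) for every x ∈ ℝ^d the map t ↦ ℒu(t,x) is continuous on (0,1]; (iv) there exists a function θ : ℝ^d → (0,1) with inf_{x ∈ ℝ^d} (θ(x) + 1 − α(x)) > 0 such that for every ε ∈ (0,1) there is a constant c(ε) > 0 with sup_{t ∈ (ε,1)} |u(t,x) − u(t,x')| ≤ c(ε) |x−x'|^{θ(x)} for all x, x' ∈ ℝ^d. Then for every t ∈ (0,1], sup_{x ∈ ℝ^d} u(t,x) ≤ sup_{x ∈ ℝ^d} u(0,x). -/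
open MeasureTheory Real Filter Topology Set

/-- The Lévy-type weight `min (η r²) K * r ^ (-(d + a))` is integrable on `ℝ^d` for `0 < a < 2`. -/
lemma integrable_min_sq_mul_norm_rpow {d : ℕ} (hd : 1 ≤ d) {a η K : ℝ} (ha : 0 < a) (ha2 : a < 2)
    (hη : 0 ≤ η) (hK : 0 ≤ K) :
    Integrable fun z : EuclideanSpace ℝ (Fin d) =>
      min (η * ‖z‖ ^ 2) K * ‖z‖ ^ (-((d : ℝ) + a)) := by
  have : Nonempty (Fin d) := ⟨⟨0, hd⟩⟩
  rw [integrable_fun_norm_addHaar volume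
    (f := fun r : ℝ => min (η * r ^ 2) K * r ^ (-((d : ℝ) + a)))]
  simp only [finrank_euclideanSpace, Fintype.card_fin, smul_eq_mul]
  have hm : Measurable fun y : ℝ =>
      y ^ (d - 1) * (min (η * y ^ 2) K * y ^ (-((d : ℝ) + a))) := by fun_prop
  have hpow : ∀ y : ℝ, 0 < y → y ^ (d - 1) * y ^ (-((d : ℝ) + a)) = y ^ (-1 - a) := by
    intro y hy
    rw [← Real.rpow_natCast y (d - 1), ← Real.rpow_add hy]
    congr 1
    push_cast [hd]
    ring
  rw [← Ioc_union_Ioi_eq_Ioi (zero_le_one' ℝ)]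
  refine IntegrableOn.union ?_ ?_
  · have hi : IntegrableOn (fun y : ℝ => η * y ^ (1 - a)) (Ioc 0 1) :=
      ((intervalIntegrable_iff_integrableOn_Ioc_of_le zero_le_one).1
        (intervalIntegral.intervalIntegrable_rpow' (by linarith))).const_mul η
    refine hi.mono' hm.aestronglyMeasurable ?_
    filter_upwards [ae_restrict_mem measurableSet_Ioc] with y hy
    have hy0 := hy.1
    rw [Real.norm_of_nonneg (by positivity)]
    calc y ^ (d - 1) * (min (η * y ^ 2) K * y ^ (-((d : ℝ) + a)))
        = min (η * y ^ 2) K * (y ^ (d - 1) * y ^ (-((d : ℝ) + a))) := by ring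
      _ ≤ (η * y ^ 2) * (y ^ (d - 1) * y ^ (-((d : ℝ) + a))) := by
          gcongr
          exact min_le_left _ _
      _ = η * y ^ (1 - a) := by
          rw [hpow y hy0, mul_assoc, ← Real.rpow_natCast y 2, ← Real.rpow_add hy0]
          congr 2
          push_cast
          ring
  · have hi : IntegrableOn (fun y : ℝ => K * y ^ (-1 - a)) (Ioi 1) :=
      (integrableOn_Ioi_rpow_of_lt (by linarith) zero_lt_one).const_mul K
    refine hi.mono' hm.aestronglyMeasurable ?_
    filter_upwards [ae_restrict_mem measurableSet_Ioi] with y hy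
    have hy0 : 0 < y := zero_lt_one.trans hy
    rw [Real.norm_of_nonneg (by positivity)]
    calc y ^ (d - 1) * (min (η * y ^ 2) K * y ^ (-((d : ℝ) + a)))
        = min (η * y ^ 2) K * (y ^ (d - 1) * y ^ (-((d : ℝ) + a))) := by ring
      _ ≤ K * (y ^ (d - 1) * y ^ (-((d : ℝ) + a))) := by
          gcongr
          exact min_le_right _ _
      _ = K * y ^ (-1 - a) := by rw [hpow y hy0]

/-- The total mass of the weight vanishes as the curvature `η` of the truncated paraboloid does. -/
lemma tendsto_integral_min_sq_mul_norm_rpow {d : ℕ} (hd : 1 ≤ d) {a K : ℝ} (ha : 0 < a)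
    (ha2 : a < 2) (hK : 0 ≤ K) :
    Tendsto (fun η : ℝ => ∫ z : EuclideanSpace ℝ (Fin d),
      min (η * ‖z‖ ^ 2) K * ‖z‖ ^ (-((d : ℝ) + a))) (𝓝[>] 0) (𝓝 0) := by
  have h0 : (∫ z : EuclideanSpace ℝ (Fin d),
      min (0 * ‖z‖ ^ 2) K * ‖z‖ ^ (-((d : ℝ) + a))) = 0 := by simp [hK]
  refine Tendsto.mono_right ?_ (congrArg 𝓝 h0).le
  refine tendsto_integral_filter_of_dominated_convergence
    (fun z => min (1 * ‖z‖ ^ 2) K * ‖z‖ ^ (-((d : ℝ) + a))) ?_ ?_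
    (integrable_min_sq_mul_norm_rpow hd ha ha2 zero_le_one hK) ?_
  · exact Eventually.of_forall fun η => Measurable.aestronglyMeasurable (by fun_prop)
  · filter_upwards [Ioc_mem_nhdsGT (zero_lt_one' ℝ)] with η hη
    refine Eventually.of_forall fun z => ?_
    have := hη.1
    rw [Real.norm_of_nonneg (by positivity)]
    gcongr
    exact hη.2
  · refine Eventually.of_forall fun z => Tendsto.mono_left ?_ nhdsWithin_le_nhds
    have : Continuous fun η : ℝ => min (η * ‖z‖ ^ 2) K * ‖z‖ ^ (-((d : ℝ) + a)) := by fun_prop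
    exact this.tendsto 0

/-- Second differences of a truncated paraboloid are bounded above by a truncated square. -/
lemma second_difference_min_norm_sq_le {E : Type*} [NormedAddCommGroup E] [InnerProductSpace ℝ E]
    {η K : ℝ} (hη : 0 ≤ η) (hK : 0 ≤ K) (x z : E) :
    min (η * ‖x + z‖ ^ 2) K + min (η * ‖x - z‖ ^ 2) K - 2 * min (η * ‖x‖ ^ 2) K
      ≤ 2 * min (η * ‖z‖ ^ 2) K := by
  have hpar : η * ‖x + z‖ ^ 2 + η * ‖x - z‖ ^ 2 = 2 * (η * ‖x‖ ^ 2) + 2 * (η * ‖z‖ ^ 2) := by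
    have := parallelogram_law_with_norm ℝ x z
    linear_combination η * this
  have hx : 0 ≤ η * ‖x‖ ^ 2 := by positivity
  have hz : 0 ≤ η * ‖z‖ ^ 2 := by positivity
  have h₁ := min_le_left (η * ‖x + z‖ ^ 2) K
  have h₂ := min_le_right (η * ‖x + z‖ ^ 2) K
  have h₃ := min_le_left (η * ‖x - z‖ ^ 2) K
  have h₄ := min_le_right (η * ‖x - z‖ ^ 2) K
  rcases min_cases (η * ‖x‖ ^ 2) K with h | h <;>
    rcases min_cases (η * ‖z‖ ^ 2) K with h' | h' <;> rw [h.1, h'.1] <;> linarith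

/-- An upper bound with a nonnegative integrable majorant, valid without integrability of `f`. -/
lemma setIntegral_le_integral_of_le {X : Type*} [MeasurableSpace X] {μ : Measure X} {f g : X → ℝ}
    (s : Set X) (hg : Integrable g μ) (hg0 : ∀ x, 0 ≤ g x) (hfg : ∀ x, f x ≤ g x) :
    ∫ x in s, f x ∂μ ≤ ∫ x, g x ∂μ := by
  by_cases hf : IntegrableOn f s μ
  · exact (integral_mono hf hg.integrableOn hfg).trans
      (setIntegral_le_integral hg (Eventually.of_forall hg0))
  · rw [integral_undef hf]
    exact integral_nonneg hg0

/-- A lower bound for the derivative at a point which is a left-sided maximum of `f - ε id`. -/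
lemma le_deriv_of_left_max {f : ℝ → ℝ} {f' ε t : ℝ} (ht : 0 < t) (hf : HasDerivAt f f' t)
    (hmax : ∀ s ∈ Ioo 0 t, f s - ε * s ≤ f t - ε * t) : ε ≤ f' := by
  refine ge_of_tendsto (hasDerivWithinAt_iff_tendsto_slope' (by simp) |>.1
    (hf.hasDerivWithinAt (s := Iio t))) ?_
  filter_upwards [Ioo_mem_nhdsLT ht] with s hs
  rw [slope_comm, slope_def_field, le_div_iff₀ (by linarith [hs.2])]
  linarith [hmax s hs]

theorem stmt17
    (d : ℕ) (hd : 1 ≤ d)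
    (α₁ α₂ : ℝ) (h1 : 0 < α₁) (h12 : α₁ ≤ α₂) (h2 : α₂ < 2)
    (α : EuclideanSpace ℝ (Fin d) → ℝ) (hαm : Measurable α)
    (hαb : ∀ x, α x ∈ Icc α₁ α₂)
    (c₁ β₁ : ℝ) (hc₁ : 0 < c₁) (hβ₁ : β₁ ∈ Ioc (0:ℝ) 1)
    (hαH : ∀ x y, |α x - α y| ≤ c₁ * min (‖x - y‖ ^ β₁) 1)
    (κ : EuclideanSpace ℝ (Fin d) → EuclideanSpace ℝ (Fin d) → ℝ)
    (hκm : Measurable fun p : EuclideanSpace ℝ (Fin d) × EuclideanSpace ℝ (Fin d) => κ p.1 p.2)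
    (κ₁ κ₂ : ℝ) (hκ1 : 0 < κ₁) (hκ12 : κ₁ ≤ κ₂)
    (hκsym : ∀ x z, κ x z = κ x (-z))
    (hκb : ∀ x z, κ x z ∈ Icc κ₁ κ₂)
    (u : ℝ → EuclideanSpace ℝ (Fin d) → ℝ)
    (hubdd : ∃ M, ∀ t ∈ Icc (0:ℝ) 1, ∀ x, |u t x| ≤ M)
    (hucont : ContinuousOn (fun p : ℝ × EuclideanSpace ℝ (Fin d) => u p.1 p.2)
      (Icc (0:ℝ) 1 ×ˢ univ))
    (Lu : ℝ → EuclideanSpace ℝ (Fin d) → ℝ)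
    -- (i) the principal value defining ℒu(t,x) exists and equals Lu t x …
    (hLu : ∀ t ∈ Ioc (0:ℝ) 1, ∀ x,
      Tendsto (fun σ : ℝ => (1 / 2) * ∫ z in {z : EuclideanSpace ℝ (Fin d) | σ < ‖z‖},
          (u t (x + z) + u t (x - z) - 2 * u t x) * κ x z * ‖z‖ ^ (-((d : ℝ) + α x)))
        (𝓝[>] (0 : ℝ)) (𝓝 (Lu t x)))
    -- … the time derivative exists and ∂ₜ u = ℒu
    (hderiv : ∀ t ∈ Ioc (0:ℝ) 1, ∀ x, HasDerivAt (fun s => u s x) (Lu t x) t)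
    -- (ii) uniform convergence of u(t,·) to u(0,·) as t ↓ 0
    (hinit : ∀ ε > 0, ∃ δ > 0, ∀ t : ℝ, 0 < t → t ≤ δ → ∀ x, |u t x - u 0 x| ≤ ε)
    -- (iii) continuity of t ↦ ℒu(t,x) on (0,1]
    (hLucont : ∀ x, ContinuousOn (fun t => Lu t x) (Ioc (0:ℝ) 1))
    -- (iv) uniform Hölder continuity in space with exponent θ(x)
    (θ : EuclideanSpace ℝ (Fin d) → ℝ) (hθ : ∀ x, θ x ∈ Ioo (0:ℝ) 1)
    (hθα : ∃ δ₀ > 0, ∀ x, δ₀ ≤ θ x + 1 - α x)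
    (hHolder : ∀ ε ∈ Ioo (0:ℝ) 1, ∃ c > 0, ∀ t ∈ Ioo ε 1, ∀ x x',
      |u t x - u t x'| ≤ c * ‖x - x'‖ ^ θ x) :
    ∀ t ∈ Ioc (0:ℝ) 1, (⨆ x, u t x) ≤ ⨆ x, u 0 x := by
  intro t₁ ht₁
  obtain ⟨M, hM⟩ := hubdd
  refine ciSup_le fun x₁ => ?_
  by_contra! hlt
  set S := ⨆ x, u 0 x
  have hS : ∀ x, u 0 x ≤ S := le_ciSup
    ⟨M, by rintro _ ⟨x, rfl⟩; exact (abs_le.1 (hM 0 (by simp) x)).2⟩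
  have hM0 : 0 ≤ M := (abs_nonneg _).trans (hM 0 (by simp) 0)
  obtain ⟨ε, hε, hεS⟩ : ∃ ε > 0, S < u t₁ x₁ - ε :=
    ⟨(u t₁ x₁ - S) / 2, by linarith, by linarith⟩
  set K := 2 * M + 2 * ε with hKdef
  have hK : 0 < K := by positivity
  have hκ2 : 0 < κ₂ := hκ1.trans_le hκ12
  -- choose the curvature of the penalization
  obtain ⟨η, hηsmall, hη⟩ : ∃ η : ℝ,
      κ₂ * ((∫ z : EuclideanSpace ℝ (Fin d), min (η * ‖z‖ ^ 2) K * ‖z‖ ^ (-((d : ℝ) + α₁)))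
        + ∫ z : EuclideanSpace ℝ (Fin d), min (η * ‖z‖ ^ 2) K * ‖z‖ ^ (-((d : ℝ) + α₂))) < ε
      ∧ 0 < η := by
    have hlim := ((tendsto_integral_min_sq_mul_norm_rpow hd h1 (h12.trans_lt h2) hK.le).add
      (tendsto_integral_min_sq_mul_norm_rpow hd (h1.trans_le h12) h2 hK.le)).const_mul κ₂
    rw [add_zero, mul_zero] at hlim
    exact ((hlim.eventually_lt_const hε).and self_mem_nhdsWithin).exists
  have hi₁ := integrable_min_sq_mul_norm_rpow hd h1 (h12.trans_lt h2) hη.le hK.le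
  have hi₂ := integrable_min_sq_mul_norm_rpow hd (h1.trans_le h12) h2 hη.le hK.le
  set w : ℝ × EuclideanSpace ℝ (Fin d) → ℝ :=
    fun p => u p.1 p.2 - ε * p.1 - min (η * ‖p.2 - x₁‖ ^ 2) K with hw
  have hw₁ : u t₁ x₁ - ε ≤ w (t₁, x₁) := by
    have : ε * t₁ ≤ ε * 1 := by gcongr; exact ht₁.2
    simp [hw, hK.le]
    linarith
  -- the penalized function attains its maximum
  obtain ⟨⟨t₀, x₀⟩, ht₀, hmax⟩ : ∃ p : ℝ × EuclideanSpace ℝ (Fin d), p.1 ∈ Icc (0:ℝ) 1 ∧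
      ∀ t ∈ Icc (0:ℝ) 1, ∀ x, w (t, x) ≤ w p := by
    have hx₁ : (t₁, x₁) ∈ Icc (0:ℝ) 1 ×ˢ Metric.closedBall x₁ (√(K / η)) :=
      ⟨Ioc_subset_Icc_self ht₁, Metric.mem_closedBall_self (by positivity)⟩
    obtain ⟨p, hp, hpmax⟩ := (isCompact_Icc.prod (isCompact_closedBall x₁ _)).exists_isMaxOn
      ⟨_, hx₁⟩ (f := w) (ContinuousOn.sub (ContinuousOn.sub
        (hucont.mono (prod_mono_right (subset_univ _))) (by fun_prop)) (by fun_prop))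
    refine ⟨p, hp.1, fun t ht x => ?_⟩
    by_cases hx : x ∈ Metric.closedBall x₁ (√(K / η))
    · exact hpmax ⟨ht, hx⟩
    · refine le_trans ?_ (hpmax hx₁)
      rw [Metric.mem_closedBall, not_le, Real.sqrt_lt (by positivity) dist_nonneg,
        div_lt_iff₀ hη, dist_eq_norm] at hx
      have hwx : w (t, x) = u t x - ε * t - K := by
        simp only [hw]
        rw [min_eq_right (by linarith)]
      have h₁ := (abs_le.1 (hM t ht x)).2
      have h₂ := (abs_le.1 (hM t₁ (Ioc_subset_Icc_self ht₁) x₁)).1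
      have h₃ : 0 ≤ ε * t := mul_nonneg hε.le ht.1
      linarith
  have ht₀pos : 0 < t₀ := by
    rcases ht₀.1.eq_or_lt with h | h
    · exfalso
      have h₁ := hmax t₁ (Ioc_subset_Icc_self ht₁) x₁
      have h₂ : w (t₀, x₀) ≤ u 0 x₀ := by
        simp only at h
        simp only [hw, ← h]
        have : 0 ≤ min (η * ‖x₀ - x₁‖ ^ 2) K := by positivity
        linarith
      linarith [hS x₀]
    · exact h
  have ht₀' : t₀ ∈ Ioc (0:ℝ) 1 := ⟨ht₀pos, ht₀.2⟩
  have hlower : ε ≤ Lu t₀ x₀ := by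
    refine le_deriv_of_left_max ht₀pos (hderiv t₀ ht₀' x₀) fun s hs => ?_
    have := hmax s ⟨hs.1.le, hs.2.le.trans ht₀.2⟩ x₀
    simp only [hw] at this
    linarith
  have hupper : Lu t₀ x₀ ≤ κ₂ * ((∫ z : EuclideanSpace ℝ (Fin d),
      min (η * ‖z‖ ^ 2) K * ‖z‖ ^ (-((d : ℝ) + α₁)))
        + ∫ z : EuclideanSpace ℝ (Fin d), min (η * ‖z‖ ^ 2) K * ‖z‖ ^ (-((d : ℝ) + α₂))) := by
    refine le_of_tendsto' (hLu t₀ ht₀' x₀) fun σ => ?_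
    have hint := setIntegral_le_integral_of_le {z : EuclideanSpace ℝ (Fin d) | σ < ‖z‖}
      (f := fun z => (u t₀ (x₀ + z) + u t₀ (x₀ - z) - 2 * u t₀ x₀) * κ x₀ z
        * ‖z‖ ^ (-((d : ℝ) + α x₀)))
      ((hi₁.add hi₂).const_mul (2 * κ₂))
      (fun z => by simp only [Pi.add_apply]; positivity) fun z => ?_
    · rw [integral_const_mul, integral_add' hi₁ hi₂] at hint
      linarith
    · have hdiff : u t₀ (x₀ + z) + u t₀ (x₀ - z) - 2 * u t₀ x₀ ≤ 2 * min (η * ‖z‖ ^ 2) K := by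
        have h₁ := hmax t₀ ht₀ (x₀ + z)
        have h₂ := hmax t₀ ht₀ (x₀ - z)
        have h₃ := second_difference_min_norm_sq_le hη.le hK.le (x₀ - x₁) z
        simp only [hw] at h₁ h₂
        rw [add_sub_right_comm] at h₁
        rw [sub_right_comm x₀] at h₂
        linarith
      have hpow : ‖z‖ ^ (-((d : ℝ) + α x₀)) ≤
          ‖z‖ ^ (-((d : ℝ) + α₁)) + ‖z‖ ^ (-((d : ℝ) + α₂)) := by
        obtain ⟨hα₁, hα₂⟩ := hαb x₀
        rcases (norm_nonneg z).eq_or_lt with hz | hz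
        · have : (d : ℝ) + α x₀ ≠ 0 := by
            have : 0 < α x₀ := h1.trans_le hα₁
            positivity
          rw [← hz, Real.zero_rpow (neg_ne_zero.2 this)]
          positivity
        · rcases le_total 1 ‖z‖ with hz1 | hz1
          · exact (Real.rpow_le_rpow_of_exponent_le hz1 (by linarith)).trans
              (le_add_of_nonneg_right (by positivity))
          · exact (Real.rpow_le_rpow_of_exponent_ge hz hz1 (by linarith)).trans
              (le_add_of_nonneg_left (by positivity))
      have hκ0 : 0 ≤ κ x₀ z := hκ1.le.trans (hκb x₀ z).1
      calc (u t₀ (x₀ + z) + u t₀ (x₀ - z) - 2 * u t₀ x₀) * κ x₀ z * ‖z‖ ^ (-((d : ℝ) + α x₀))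
          ≤ (2 * min (η * ‖z‖ ^ 2) K) * κ₂ *
            (‖z‖ ^ (-((d : ℝ) + α₁)) + ‖z‖ ^ (-((d : ℝ) + α₂))) := by
            gcongr
            exact (hκb x₀ z).2
        _ = _ := by
            simp only [Pi.add_apply]
            ring
  linarith
end
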